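/- arXiv:2503.12716 — 7 statements merged into one kernel-verified Lean document; each statement's English description precedes it below -/
import Mathlib

section
/- The 2×2 multiplicity block g₁(z) of the R-matrix of type D_{r+1}^{(2)} on the two-dimensional multiplicity space of the summand L_{ω₁} satisfies g₁(1) = Id₂, the inversion relation g₁(z)·g₁(z⁻¹) = Id₂, and g₁(0) = [[0, q^{−2}],[q^{−2}, 0]]. -/
open scoped Kronecker Matrix

set_option maxHeartbeats 1000000
set_option synthInstance.maxHeartbeats 1000000

namespace Stmt12

noncomputable section

/-- the quantum number `[n]_k = (q^{kn} - q^{-kn})/(q^k - q^{-k})`. -/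
def qnum {F : Type*} [Field F] (q : F) (n k : ℤ) : F :=
  (q ^ (k * n) - q ^ (-(k * n))) / (q ^ k - q ^ (-k))

/-- the quantum number `[n]_kⁱ = (q^{kn} + (-1)^{n-1} q^{-kn})/(q^k + q^{-k})`. -/
def qnumi {F : Type*} [Field F] (q : F) (n k : ℤ) : F :=
  (q ^ (k * n) + (-1 : F) ^ (n - 1) * q ^ (-(k * n))) / (q ^ k + q ^ (-k))

abbrev F : Type := RatFunc (RatFunc ℂ)

def q : F := RatFunc.C RatFunc.X

/-- the spectral variable `z` -/
def zvar : F := RatFunc.X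

/-- `β = [2]·[2]ⁱ`. -/
def beta : F := qnum q 2 1 * qnumi q 2 1

/-- the 2×2 multiplicity block `g₁(z)` of the R-matrix of type D_{r+1}^{(2)}
on the multiplicity space of the summand `L_{ω₁}`. -/
def g1 (z : F) : Matrix (Fin 2) (Fin 2) F :=
  (q ^ (-2 : ℤ) / (1 - q ^ (-4 : ℤ) * z ^ 2)) •
    !![beta * z, 1 - z ^ 2; 1 - z ^ 2, beta * z]

theorem RatFunc_X_pow_ne_C {K : Type*} [Field K] {n : ℕ} (hn : n ≠ 0) (a : K) :
    (RatFunc.X : RatFunc K) ^ n ≠ RatFunc.C a := by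
  rw [← RatFunc.algebraMap_X, ← RatFunc.algebraMap_C, ← map_pow]
  intro h
  have h' := congrArg Polynomial.natDegree (RatFunc.algebraMap_injective K h)
  rw [Polynomial.natDegree_X_pow, Polynomial.natDegree_C] at h'
  exact hn h'

theorem RatFunc_C_mul_X_pow_ne_one {K : Type*} [Field K] {n : ℕ} (hn : n ≠ 0) (a : K) :
    RatFunc.C a * (RatFunc.X : RatFunc K) ^ n ≠ 1 := by
  rw [← RatFunc.algebraMap_X, ← RatFunc.algebraMap_C, ← map_pow, ← map_mul,
    ← map_one (algebraMap (Polynomial K) (RatFunc K))]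
  intro h
  have h' := congrArg (Polynomial.eval 0) (RatFunc.algebraMap_injective K h)
  simp [hn] at h'

theorem q_ne_zero : q ≠ 0 :=
  (map_ne_zero RatFunc.C).2 RatFunc.X_ne_zero

theorem zvar_ne_zero : zvar ≠ 0 := RatFunc.X_ne_zero

theorem q_pow_four_ne_one : q ^ 4 ≠ 1 := by
  intro h
  rw [q, ← map_pow, ← map_one RatFunc.C] at h
  have h' := (RatFunc.C (K := RatFunc ℂ)).injective h
  rw [← map_one RatFunc.C] at h'
  exact RatFunc_X_pow_ne_C (by norm_num) 1 h'

theorem zvar_sq_ne_q_pow_four : zvar ^ 2 ≠ q ^ 4 := by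
  rw [q, ← map_pow]
  exact RatFunc_X_pow_ne_C two_ne_zero _

theorem q_pow_four_mul_zvar_sq_ne_one : q ^ 4 * zvar ^ 2 ≠ 1 := by
  rw [q, ← map_pow]
  exact RatFunc_C_mul_X_pow_ne_one two_ne_zero _

theorem qnum_two_mul_qnumi_two {K : Type*} [Field K] {p : K} (hp : p ≠ 0) (h : p ^ 4 ≠ 1) :
    qnum p 2 1 * qnumi p 2 1 = p ^ 2 - (p ^ 2)⁻¹ := by
  have h1 : p ^ 2 - 1 ≠ 0 := fun e => h (by linear_combination (p ^ 2 + 1) * e)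
  have h2 : p ^ 2 + 1 ≠ 0 := fun e => h (by linear_combination (p ^ 2 - 1) * e)
  have h3 : p - p⁻¹ ≠ 0 := by
    have : p - p⁻¹ = (p ^ 2 - 1) / p := by field_simp
    rw [this]
    exact div_ne_zero h1 hp
  have h4 : p + p⁻¹ ≠ 0 := by
    have : p + p⁻¹ = (p ^ 2 + 1) / p := by field_simp
    rw [this]
    exact div_ne_zero h2 hp
  have e1 : p ^ (2 : ℤ) = p ^ 2 := by norm_cast
  have e2 : (-1 : K) ^ ((2 : ℤ) - 1) = -1 := by norm_num
  simp only [qnum, qnumi, one_mul, zpow_neg, zpow_one, e1, e2]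
  rw [div_mul_div_comm, div_eq_iff (mul_ne_zero h3 h4)]
  field_simp
  ring

theorem beta_eq : beta = q ^ 2 - (q ^ 2)⁻¹ :=
  qnum_two_mul_qnumi_two q_ne_zero q_pow_four_ne_one

theorem zpow_neg_natCast_eq_inv_pow {K : Type*} [Field K] (p : K) (n : ℕ) :
    p ^ (-(n : ℤ)) = (p ^ n)⁻¹ := by
  rw [zpow_neg, zpow_natCast]

theorem q_zpow_neg_two : q ^ (-2 : ℤ) = (q ^ 2)⁻¹ :=
  zpow_neg_natCast_eq_inv_pow q 2

theorem q_zpow_neg_four : q ^ (-4 : ℤ) = (q ^ 4)⁻¹ :=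
  zpow_neg_natCast_eq_inv_pow q 4

/-- The block `g₁(z)` with its denominator cleared of negative powers of `q`. -/
theorem g1_eq (z : F) :
    g1 z = (q ^ 4 - z ^ 2)⁻¹ •
      !![(q ^ 4 - 1) * z, q ^ 2 * (1 - z ^ 2); q ^ 2 * (1 - z ^ 2), (q ^ 4 - 1) * z] := by
  have hq := q_ne_zero
  have hd : 1 - (q ^ 4)⁻¹ * z ^ 2 = (q ^ 4 - z ^ 2) / q ^ 4 := by field_simp
  rw [g1, beta_eq, q_zpow_neg_two, q_zpow_neg_four, hd]
  generalize q ^ 4 - z ^ 2 = d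
  ext i j
  fin_cases i <;> fin_cases j <;> simp <;> field_simp

theorem g1_one : g1 1 = 1 := by
  have h : q ^ 4 - 1 ≠ 0 := sub_ne_zero.2 q_pow_four_ne_one
  rw [g1_eq]
  ext i j
  fin_cases i <;> fin_cases j <;> simp <;> exact inv_mul_cancel₀ (G₀ := F) h

theorem g1_zero : g1 0 = !![0, q ^ (-2 : ℤ); q ^ (-2 : ℤ), 0] := by
  have hq := q_ne_zero
  rw [g1_eq, q_zpow_neg_two]
  ext i j
  fin_cases i <;> fin_cases j <;> simp <;> field_simp

theorem g1_mul_g1_inv {z : F} (hz : z ≠ 0) (h1 : z ^ 2 ≠ q ^ 4) (h2 : q ^ 4 * z ^ 2 ≠ 1) :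
    g1 z * g1 z⁻¹ = 1 := by
  have d1 : q ^ 4 - z ^ 2 ≠ 0 := sub_ne_zero.2 h1.symm
  have d2 : q ^ 4 * z ^ 2 - 1 ≠ 0 := sub_ne_zero.2 h2
  have hd : q ^ 4 - z⁻¹ ^ 2 = (q ^ 4 * z ^ 2 - 1) / z ^ 2 := by field_simp
  rw [g1_eq, g1_eq, hd]
  generalize q = p at *
  ext i j
  fin_cases i <;> fin_cases j <;> simp [Matrix.mul_apply, Fin.sum_univ_two] <;> field_simp <;> ring

/-- `g₁(1) = Id`, the inversion relation `g₁(z)g₁(z⁻¹) = Id`, and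
`g₁(0) = [[0, q⁻²],[q⁻², 0]]` for type D_{r+1}^{(2)}. -/
theorem D2_g1_properties :
    g1 1 = 1 ∧ g1 zvar * g1 zvar⁻¹ = 1 ∧
    g1 0 = !![0, q ^ (-2 : ℤ); q ^ (-2 : ℤ), 0] :=
  ⟨g1_one, g1_mul_g1_inv zvar_ne_zero zvar_sq_ne_q_pow_four q_pow_four_mul_zvar_sq_ne_one, g1_zero⟩

end
end Stmt12
end

section
/- The 2×2 multiplicity block g₂(z) of the R-matrix of type D_{r+1}^{(2)} on the two-dimensional multiplicity space of the trivial summand L_{ω₀} satisfies g₂(1) = Id₂, the inversion relation g₂(z)·g₂(z⁻¹) = Id₂, and g₂(0) = diag(q^{−4r−2}, q^{−2}). -/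
open scoped Kronecker Matrix

set_option maxHeartbeats 1000000
set_option synthInstance.maxHeartbeats 1000000

namespace Stmt13

noncomputable section

/-- the quantum number `[n]_k = (q^{kn} - q^{-kn})/(q^k - q^{-k})`. -/
def qnum {F : Type*} [Field F] (q : F) (n k : ℤ) : F :=
  (q ^ (k * n) - q ^ (-(k * n))) / (q ^ k - q ^ (-k))

/-- the quantum number `[n]_kⁱ = (q^{kn} + (-1)^{n-1} q^{-kn})/(q^k + q^{-k})`. -/
def qnumi {F : Type*} [Field F] (q : F) (n k : ℤ) : F :=
  (q ^ (k * n) + (-1 : F) ^ (n - 1) * q ^ (-(k * n))) / (q ^ k + q ^ (-k))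

abbrev F : Type := RatFunc (RatFunc ℂ)

def q : F := RatFunc.C RatFunc.X

/-- the spectral variable `z` -/
def zvar : F := RatFunc.X

/-- `α = [2]_{2r+2} - [2]_{2r} - [2]_{2r-2}`. -/
def alpha (r : ℕ) : F :=
  qnum q 2 (2 * (r : ℤ) + 2) - qnum q 2 (2 * (r : ℤ)) - qnum q 2 (2 * (r : ℤ) - 2)

/-- `β = [2]·[2]ⁱ`. -/
def beta : F := qnum q 2 1 * qnumi q 2 1

/-- `γ = [2]_{2r-1}·[2]_{2r+1}ⁱ`. -/
def gam (r : ℕ) : F := qnum q 2 (2 * (r : ℤ) - 1) * qnumi q 2 (2 * (r : ℤ) + 1)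

/-- the matrix `f_{ω₀}(z)` of type D_{r+1}^{(2)}. -/
def f (r : ℕ) (z : F) : Matrix (Fin 2) (Fin 2) F :=
  !![q ^ (-(2 * (r : ℤ))) + alpha r * z ^ 2 + q ^ (2 * (r : ℤ)) * z ^ 4,
      beta * z * (1 - z ^ 2);
    gam r * z * (1 - z ^ 2),
      q ^ (2 * (r : ℤ)) + alpha r * z ^ 2 + q ^ (-(2 * (r : ℤ))) * z ^ 4]

/-- the 2×2 multiplicity block `g₂(z)` of the R-matrix of type D_{r+1}^{(2)}
on the multiplicity space of the trivial summand `L_{ω₀}`. -/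
def g2 (r : ℕ) (z : F) : Matrix (Fin 2) (Fin 2) F :=
  (q ^ (-(2 * (r : ℤ) + 2)) /
      ((1 - q ^ (-4 : ℤ) * z ^ 2) * (1 - q ^ (-(4 * (r : ℤ))) * z ^ 2))) • f r z

lemma ratFunc_X_pow_ne_C {K : Type*} [Field K] {n : ℕ} (hn : n ≠ 0) (a : K) :
    (RatFunc.X : RatFunc K) ^ n ≠ RatFunc.C a := by
  intro h
  have h' : algebraMap (Polynomial K) (RatFunc K) (Polynomial.X ^ n) =
      algebraMap (Polynomial K) (RatFunc K) (Polynomial.C a) := by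
    simpa using h
  have hd := congrArg Polynomial.natDegree (IsFractionRing.injective _ _ h')
  simp at hd
  exact hn hd

section Generic

variable {K : Type*} [Field K] {x : K}

lemma qnum_two {k : ℤ} (h : x ^ k - x ^ (-k) ≠ 0) :
    qnum x 2 k = x ^ k + x ^ (-k) := by
  rw [qnum, div_eq_iff h, ← neg_mul, zpow_mul, zpow_mul]
  norm_cast
  ring

lemma qnumi_two {k : ℤ} (h : x ^ k + x ^ (-k) ≠ 0) :
    qnumi x 2 k = x ^ k - x ^ (-k) := by
  rw [qnumi, div_eq_iff h, ← neg_mul, zpow_mul, zpow_mul]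
  norm_num
  ring

lemma qnum_two_natCast (hx : x ≠ 0) (hx1 : ∀ n : ℕ, n ≠ 0 → x ^ n ≠ 1) {n : ℕ} (hn : n ≠ 0) :
    qnum x 2 n = x ^ n + (x ^ n)⁻¹ := by
  have h0 : x ^ n ≠ 0 := pow_ne_zero _ hx
  rw [qnum_two, zpow_neg, zpow_natCast]
  rw [zpow_neg, zpow_natCast, sub_ne_zero]
  intro h
  refine hx1 (n + n) (by omega) ?_
  rw [pow_add]
  exact (eq_mul_inv_iff_mul_eq₀ h0).1 (h.trans (one_mul _).symm)

lemma qnumi_two_natCast (hx : x ≠ 0) (hx1 : ∀ n : ℕ, n ≠ 0 → x ^ n ≠ 1) {n : ℕ} (hn : n ≠ 0) :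
    qnumi x 2 n = x ^ n - (x ^ n)⁻¹ := by
  have h0 : x ^ n ≠ 0 := pow_ne_zero _ hx
  rw [qnumi_two, zpow_neg, zpow_natCast]
  rw [zpow_neg, zpow_natCast]
  intro h
  have h1 : x ^ n * x ^ n + 1 = 0 := by
    rw [← mul_inv_cancel₀ h0, ← mul_add, h, mul_zero]
  refine hx1 ((n + n) * 2) (by omega) ?_
  rw [pow_mul, pow_add, eq_neg_of_add_eq_zero_left h1]
  norm_num

/-- `alpha` with an arbitrary element `x` of a field in place of `q`. -/
def alphaAt (x : K) (r : ℕ) : K :=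
  qnum x 2 (2 * (r : ℤ) + 2) - qnum x 2 (2 * (r : ℤ)) - qnum x 2 (2 * (r : ℤ) - 2)

/-- `beta` with an arbitrary element `x` of a field in place of `q`. -/
def betaAt (x : K) : K := qnum x 2 1 * qnumi x 2 1

/-- `gam` with an arbitrary element `x` of a field in place of `q`. -/
def gamAt (x : K) (r : ℕ) : K := qnum x 2 (2 * (r : ℤ) - 1) * qnumi x 2 (2 * (r : ℤ) + 1)

/-- `g2` with an arbitrary element `x` of a field in place of `q`. -/
def g2At (x : K) (r : ℕ) (z : K) : Matrix (Fin 2) (Fin 2) K :=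
  (x ^ (-(2 * (r : ℤ) + 2)) /
      ((1 - x ^ (-4 : ℤ) * z ^ 2) * (1 - x ^ (-(4 * (r : ℤ))) * z ^ 2))) •
    !![x ^ (-(2 * (r : ℤ))) + alphaAt x r * z ^ 2 + x ^ (2 * (r : ℤ)) * z ^ 4,
        betaAt x * z * (1 - z ^ 2);
      gamAt x r * z * (1 - z ^ 2),
        x ^ (2 * (r : ℤ)) + alphaAt x r * z ^ 2 + x ^ (-(2 * (r : ℤ))) * z ^ 4]

lemma alphaAt_eq (hx : x ≠ 0) (hx1 : ∀ n : ℕ, n ≠ 0 → x ^ n ≠ 1) {r : ℕ} (hr : 2 ≤ r) :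
    alphaAt x r = x ^ (2 * r) * x ^ 2 + (x ^ (2 * r) * x ^ 2)⁻¹ - (x ^ (2 * r) + (x ^ (2 * r))⁻¹)
      - (x ^ (2 * r) / x ^ 2 + (x ^ (2 * r) / x ^ 2)⁻¹) := by
  have h1 := qnum_two_natCast hx hx1 (n := 2 * r + 2) (by omega)
  have h2 := qnum_two_natCast hx hx1 (n := 2 * r) (by omega)
  have h3 := qnum_two_natCast hx hx1 (n := 2 * r - 2) (by omega)
  rw [pow_sub₀ _ hx (by omega), ← div_eq_mul_inv] at h3
  push_cast [Nat.cast_sub (show 2 ≤ 2 * r by omega)] at h1 h2 h3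
  rw [alphaAt, h1, h2, h3, pow_add]

lemma betaAt_eq (hx : x ≠ 0) (hx1 : ∀ n : ℕ, n ≠ 0 → x ^ n ≠ 1) :
    betaAt x = x ^ 2 - (x ^ 2)⁻¹ := by
  have h1 := qnum_two_natCast hx hx1 (n := 1) one_ne_zero
  have h2 := qnumi_two_natCast hx hx1 (n := 1) one_ne_zero
  push_cast at h1 h2
  rw [betaAt, h1, h2]
  ring

lemma gamAt_eq (hx : x ≠ 0) (hx1 : ∀ n : ℕ, n ≠ 0 → x ^ n ≠ 1) {r : ℕ} (hr : 2 ≤ r) :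
    gamAt x r =
      (x ^ (2 * r) / x + (x ^ (2 * r) / x)⁻¹) * (x ^ (2 * r) * x - (x ^ (2 * r) * x)⁻¹) := by
  have h1 := qnum_two_natCast hx hx1 (n := 2 * r - 1) (by omega)
  have h2 := qnumi_two_natCast hx hx1 (n := 2 * r + 1) (by omega)
  rw [pow_sub₀ _ hx (by omega), ← div_eq_mul_inv, pow_one] at h1
  push_cast [Nat.cast_sub (show 1 ≤ 2 * r by omega)] at h1 h2
  rw [gamAt, h1, h2, pow_succ]

lemma g2At_eq (x : K) (r : ℕ) (z : K) :
    g2At x r z = ((x ^ (2 * r) * x ^ 2)⁻¹ /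
        ((1 - (x ^ 4)⁻¹ * z ^ 2) * (1 - ((x ^ (2 * r)) ^ 2)⁻¹ * z ^ 2))) •
      !![(x ^ (2 * r))⁻¹ + alphaAt x r * z ^ 2 + x ^ (2 * r) * z ^ 4, betaAt x * z * (1 - z ^ 2);
        gamAt x r * z * (1 - z ^ 2), x ^ (2 * r) + alphaAt x r * z ^ 2 + (x ^ (2 * r))⁻¹ * z ^ 4] := by
  have e1 : x ^ (-(2 * (r : ℤ) + 2)) = (x ^ (2 * r) * x ^ 2)⁻¹ := by
    rw [zpow_neg, ← pow_add]; norm_cast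
  have e2 : x ^ (-(4 * (r : ℤ))) = ((x ^ (2 * r)) ^ 2)⁻¹ := by
    rw [zpow_neg, ← pow_mul, show 2 * r * 2 = 4 * r by ring]; norm_cast
  have e3 : x ^ (-(2 * (r : ℤ))) = (x ^ (2 * r))⁻¹ := by
    rw [zpow_neg]; norm_cast
  have e4 : x ^ (2 * (r : ℤ)) = x ^ (2 * r) := by norm_cast
  have e5 : x ^ (-4 : ℤ) = (x ^ 4)⁻¹ := by rw [zpow_neg]; norm_cast
  rw [g2At, e1, e2, e3, e4, e5]

theorem g2At_properties {z : K} (hx : x ≠ 0) (hx1 : ∀ n : ℕ, n ≠ 0 → x ^ n ≠ 1) (hz : z ≠ 0)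
    (hzx : ∀ n : ℕ, z ^ 2 ≠ x ^ n) (hzx1 : ∀ n : ℕ, z ^ 2 * x ^ n ≠ 1) {r : ℕ} (hr : 2 ≤ r) :
    g2At x r 1 = 1 ∧ g2At x r z * g2At x r z⁻¹ = 1 ∧
    g2At x r 0 = !![x ^ (-(4 * (r : ℤ)) - 2), 0; 0, x ^ (-2 : ℤ)] := by
  have hu : x ^ (2 * r) ≠ 0 := pow_ne_zero _ hx
  have hx4 : x ^ 4 - 1 ≠ 0 := sub_ne_zero.2 (hx1 _ (by norm_num))
  have e2 : (x ^ (2 * r)) ^ 2 = x ^ (4 * r) := by rw [← pow_mul]; congr 1; ring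
  have hu2 : (x ^ (2 * r)) ^ 2 - 1 ≠ 0 := by
    rw [e2]; exact sub_ne_zero.2 (hx1 _ (by omega))
  have a1 : x ^ 4 - z ^ 2 ≠ 0 := sub_ne_zero.2 (hzx 4).symm
  have a2 : (x ^ (2 * r)) ^ 2 - z ^ 2 ≠ 0 := by
    rw [e2]; exact sub_ne_zero.2 (hzx _).symm
  have a3 : z ^ 2 * x ^ 4 - 1 ≠ 0 := sub_ne_zero.2 (hzx1 4)
  have a4 : z ^ 2 * (x ^ (2 * r)) ^ 2 - 1 ≠ 0 := by
    rw [e2]; exact sub_ne_zero.2 (hzx1 _)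
  have ez1 : x ^ (-(4 * (r : ℤ)) - 2) = ((x ^ (2 * r)) ^ 2 * x ^ 2)⁻¹ := by
    rw [e2, ← pow_add, show -(4 * (r : ℤ)) - 2 = -((4 * r + 2 : ℕ) : ℤ) by push_cast; ring,
      zpow_neg, zpow_natCast]
  have ez2 : x ^ (-2 : ℤ) = (x ^ 2)⁻¹ := by rw [zpow_neg]; norm_cast
  rw [g2At_eq, g2At_eq, g2At_eq, g2At_eq, alphaAt_eq hx hx1 hr, betaAt_eq hx hx1,
    gamAt_eq hx hx1 hr, ez1, ez2]
  generalize x ^ (2 * r) = u at *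
  have b1 : 1 - (x ^ 4)⁻¹ * z ^ 2 = (x ^ 4 - z ^ 2) / x ^ 4 := by field_simp
  have b2 : 1 - (u ^ 2)⁻¹ * z ^ 2 = (u ^ 2 - z ^ 2) / u ^ 2 := by field_simp
  have b3 : 1 - (x ^ 4)⁻¹ * z⁻¹ ^ 2 = (z ^ 2 * x ^ 4 - 1) / (z ^ 2 * x ^ 4) := by field_simp
  have b4 : 1 - (u ^ 2)⁻¹ * z⁻¹ ^ 2 = (z ^ 2 * u ^ 2 - 1) / (z ^ 2 * u ^ 2) := by field_simp
  have b5 : 1 - (x ^ 4)⁻¹ * 1 ^ 2 = (x ^ 4 - 1) / x ^ 4 := by field_simp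
  have b6 : 1 - (u ^ 2)⁻¹ * 1 ^ 2 = (u ^ 2 - 1) / u ^ 2 := by field_simp
  rw [b1, b2, b3, b4, b5, b6]
  refine ⟨?_, ?_, ?_⟩
  · ext i j
    fin_cases i <;> fin_cases j <;> simp <;> field_simp <;> ring
  · have a5 : x ^ 4 * z ^ 2 - 1 ≠ 0 := by rwa [mul_comm]
    have a6 : u ^ 2 * z ^ 2 - 1 ≠ 0 := by rwa [mul_comm]
    rw [Matrix.smul_mul, Matrix.mul_smul, Matrix.mul_fin_two, smul_smul]
    ext i j
    fin_cases i <;> fin_cases j <;>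
      simp only [Fin.zero_eta, Fin.mk_one, Fin.isValue, Matrix.smul_apply, Matrix.of_apply,
        Matrix.cons_val', Matrix.cons_val_zero, Matrix.cons_val_one, Matrix.cons_val_fin_one,
        smul_eq_mul, Matrix.one_apply_eq, ne_eq, zero_ne_one, one_ne_zero, not_false_eq_true,
        Matrix.one_apply_ne] <;>
      field_simp <;> ring
  · ext i j
    fin_cases i <;> fin_cases j <;> simp <;> field_simp

end Generic

lemma q_ne_zero : q ≠ 0 := by
  simp [q, RatFunc.X_ne_zero]

lemma q_pow_ne_one (n : ℕ) (hn : n ≠ 0) : q ^ n ≠ 1 := by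
  intro h
  have h' : RatFunc.C ((RatFunc.X : RatFunc ℂ) ^ n) = RatFunc.C 1 := by
    rw [map_pow, map_one]
    exact h
  refine ratFunc_X_pow_ne_C hn (1 : ℂ) ?_
  rw [map_one]
  exact RatFunc.C_injective h'

lemma zvar_sq_ne_q_pow (n : ℕ) : zvar ^ 2 ≠ q ^ n := by
  intro h
  refine ratFunc_X_pow_ne_C two_ne_zero ((RatFunc.X : RatFunc ℂ) ^ n) ?_
  rw [map_pow]
  exact h

lemma zvar_sq_mul_q_pow_ne_one (n : ℕ) : zvar ^ 2 * q ^ n ≠ 1 := by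
  intro h
  refine ratFunc_X_pow_ne_C two_ne_zero ((RatFunc.X : RatFunc ℂ) ^ n)⁻¹ ?_
  rw [map_inv₀, map_pow]
  exact eq_inv_of_mul_eq_one_left h

/-- `g₂(1) = Id`, the inversion relation `g₂(z)g₂(z⁻¹) = Id`, and
`g₂(0) = diag(q^{-4r-2}, q^{-2})` for type D_{r+1}^{(2)}. -/
theorem D2_g2_properties (r : ℕ) (hr : 2 ≤ r) :
    g2 r 1 = 1 ∧ g2 r zvar * g2 r zvar⁻¹ = 1 ∧
    g2 r 0 = !![q ^ (-(4 * (r : ℤ)) - 2), 0; 0, q ^ (-2 : ℤ)] := by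
  exact g2At_properties q_ne_zero q_pow_ne_one RatFunc.X_ne_zero zvar_sq_ne_q_pow
    zvar_sq_mul_q_pow_ne_one hr

end
end Stmt13
end

section
/- The 3×3 multiplicity block g₁(z) of the R-matrix of type E₆^{(2)} on the three-dimensional multiplicity space of the summand L_{ω₁} satisfies g₁(1) = Id₃ and the inversion relation g₁(z)·g₁(z⁻¹) = Id₃. -/
open scoped Kronecker Matrix

set_option maxHeartbeats 1000000
set_option synthInstance.maxHeartbeats 1000000

namespace Stmt14

noncomputable section

/-- the quantum number `[n]_k = (q^{kn} - q^{-kn})/(q^k - q^{-k})`. -/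
def qnum {F : Type*} [Field F] (q : F) (n k : ℤ) : F :=
  (q ^ (k * n) - q ^ (-(k * n))) / (q ^ k - q ^ (-k))

/-- the quantum number `[n]_kⁱ = (q^{kn} + (-1)^{n-1} q^{-kn})/(q^k + q^{-k})`. -/
def qnumi {F : Type*} [Field F] (q : F) (n k : ℤ) : F :=
  (q ^ (k * n) + (-1 : F) ^ (n - 1) * q ^ (-(k * n))) / (q ^ k + q ^ (-k))

/-- `α = [2]ⁱ·([3] - [2]₆)/[3]`. -/
def alpha {F : Type*} [Field F] (q : F) : F :=
  qnumi q 2 1 * (qnum q 3 1 - qnum q 2 6) / qnum q 3 1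

/-- `β = [2]ⁱ·[4]/[3]`. -/
def beta {F : Type*} [Field F] (q : F) : F := qnumi q 2 1 * qnum q 4 1 / qnum q 3 1

/-- `γ = [2]ⁱ·[2]·[2]₆·[7]/[3]`. -/
def gam {F : Type*} [Field F] (q : F) : F :=
  qnumi q 2 1 * qnum q 2 1 * qnum q 2 6 * qnum q 7 1 / qnum q 3 1

/-- the matrix `f_{ω₁}(z)` of type E₆^{(2)}. -/
def f {F : Type*} [Field F] (q z : F) : Matrix (Fin 3) (Fin 3) F :=
  !![(q ^ (-3 : ℤ) - q ^ (3 : ℤ) * z) * (q ^ (-3 : ℤ) + alpha q * z - q ^ (3 : ℤ) * z ^ 2),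
      beta q * z * (1 - z), beta q * z * (1 - z);
    gam q * z * (1 - z), beta q * z * (q ^ (6 : ℤ) - q ^ (-6 : ℤ) * z),
      (1 - z) * (q ^ (6 : ℤ) + beta q * z - q ^ (-6 : ℤ) * z ^ 2);
    gam q * z * (1 - z), (1 - z) * (q ^ (6 : ℤ) + beta q * z - q ^ (-6 : ℤ) * z ^ 2),
      beta q * z * (q ^ (6 : ℤ) - q ^ (-6 : ℤ) * z)]

/-- the 3×3 multiplicity block `g₁(z)` of the R-matrix of type E₆^{(2)}
on the multiplicity space of the summand `L_{ω₁}`. -/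
def g1 {F : Type*} [Field F] (q z : F) : Matrix (Fin 3) (Fin 3) F :=
  (q ^ (-8 : ℤ) /
      ((1 - q ^ (-2 : ℤ) * z) * (1 + q ^ (-6 : ℤ) * z) * (1 - q ^ (-8 : ℤ) * z))) • f q z

abbrev F : Type := RatFunc (RatFunc ℂ)

def q : F := RatFunc.C RatFunc.X

/-- the spectral variable `z` -/
def zvar : F := RatFunc.X

section Field

variable {K : Type*} [Field K] {q z : K}

theorem pow_ne_one_of_dvd {n : ℕ} (h : q ^ 24 ≠ 1) (hn : n ∣ 24) : q ^ n ≠ 1 := by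
  obtain ⟨m, hm⟩ := hn
  intro hq
  exact h (by rw [hm, pow_mul, hq, one_pow])

theorem sq_add_one_ne_zero (h : q ^ 24 ≠ 1) : q ^ 2 + 1 ≠ 0 := fun h0 =>
  pow_ne_one_of_dvd (n := 4) h (by decide) (by linear_combination (q ^ 2 - 1) * h0)

theorem pow_four_add_sq_add_one_ne_zero (h : q ^ 24 ≠ 1) : q ^ 4 + q ^ 2 + 1 ≠ 0 := fun h0 =>
  pow_ne_one_of_dvd (n := 6) h (by decide) (by linear_combination (q ^ 2 - 1) * h0)

theorem qnum_eq {k n : ℤ} {c : K} (hk : q ^ k - q ^ (-k) ≠ 0)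
    (hc : q ^ (k * n) - q ^ (-(k * n)) = c * (q ^ k - q ^ (-k))) : qnum q n k = c :=
  (div_eq_iff hk).2 hc

theorem sub_inv_ne_zero {n : ℕ} (hq : q ≠ 0) (h : q ^ 24 ≠ 1) (hn : 2 * n ∣ 24) :
    q ^ (n : ℤ) - q ^ (-(n : ℤ)) ≠ 0 := by
  intro h0
  refine pow_ne_one_of_dvd h hn ?_
  rw [zpow_neg, zpow_natCast, sub_eq_zero] at h0
  rw [two_mul, pow_add]
  nth_rewrite 1 [h0]
  exact inv_mul_cancel₀ (pow_ne_zero n hq)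

theorem qnum_two_one (hq : q ≠ 0) (h : q ^ 24 ≠ 1) : qnum q 2 1 = (q ^ 2 + 1) / q := by
  refine qnum_eq (sub_inv_ne_zero (n := 1) hq h (by decide)) ?_
  norm_num [zpow_neg]
  norm_cast
  field_simp
  ring

theorem qnum_three_one (hq : q ≠ 0) (h : q ^ 24 ≠ 1) :
    qnum q 3 1 = (q ^ 4 + q ^ 2 + 1) / q ^ 2 := by
  refine qnum_eq (sub_inv_ne_zero (n := 1) hq h (by decide)) ?_
  norm_num [zpow_neg]
  norm_cast
  field_simp
  ring

theorem qnum_four_one (hq : q ≠ 0) (h : q ^ 24 ≠ 1) :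
    qnum q 4 1 = (q ^ 6 + q ^ 4 + q ^ 2 + 1) / q ^ 3 := by
  refine qnum_eq (sub_inv_ne_zero (n := 1) hq h (by decide)) ?_
  norm_num [zpow_neg]
  norm_cast
  field_simp
  ring

theorem qnum_seven_one (hq : q ≠ 0) (h : q ^ 24 ≠ 1) :
    qnum q 7 1 = (q ^ 12 + q ^ 10 + q ^ 8 + q ^ 6 + q ^ 4 + q ^ 2 + 1) / q ^ 6 := by
  refine qnum_eq (sub_inv_ne_zero (n := 1) hq h (by decide)) ?_
  norm_num [zpow_neg]
  norm_cast
  field_simp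
  ring

theorem qnum_two_six (hq : q ≠ 0) (h : q ^ 24 ≠ 1) : qnum q 2 6 = (q ^ 12 + 1) / q ^ 6 := by
  refine qnum_eq (sub_inv_ne_zero (n := 6) hq h (by decide)) ?_
  norm_num [zpow_neg]
  norm_cast
  field_simp
  ring

theorem qnumi_two_one (hq : q ≠ 0) (h : q ^ 24 ≠ 1) : qnumi q 2 1 = (q ^ 2 - 1) / q := by
  have h2 := sq_add_one_ne_zero h
  norm_num [qnumi, zpow_neg]
  norm_cast
  field_simp
  ring

theorem alpha_eq (hq : q ≠ 0) (h : q ^ 24 ≠ 1) :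
    alpha q = (q ^ 2 - 1) * (q ^ 8 + q ^ 6 + q ^ 4 - q ^ 12 - 1) /
      (q ^ 5 * (q ^ 4 + q ^ 2 + 1)) := by
  have h3 := pow_four_add_sq_add_one_ne_zero h
  rw [alpha, qnumi_two_one hq h, qnum_three_one hq h, qnum_two_six hq h]
  field_simp
  ring

theorem beta_eq (hq : q ≠ 0) (h : q ^ 24 ≠ 1) :
    beta q = (q ^ 8 - 1) / (q ^ 2 * (q ^ 4 + q ^ 2 + 1)) := by
  have h3 := pow_four_add_sq_add_one_ne_zero h
  rw [beta, qnumi_two_one hq h, qnum_three_one hq h, qnum_four_one hq h]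
  field_simp
  ring

theorem gam_eq (hq : q ≠ 0) (h : q ^ 24 ≠ 1) :
    gam q = (q ^ 4 - 1) * (q ^ 12 + 1) *
      (q ^ 12 + q ^ 10 + q ^ 8 + q ^ 6 + q ^ 4 + q ^ 2 + 1) /
        (q ^ 12 * (q ^ 4 + q ^ 2 + 1)) := by
  have h3 := pow_four_add_sq_add_one_ne_zero h
  rw [gam, qnumi_two_one hq h, qnum_three_one hq h, qnum_two_one hq h, qnum_two_six hq h,
    qnum_seven_one hq h]
  field_simp
  ring

/-- The denominator of the scalar prefactor of `g₁(z)`. -/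
def g1Denom (q z : K) : K :=
  (1 - q ^ (-2 : ℤ) * z) * (1 + q ^ (-6 : ℤ) * z) * (1 - q ^ (-8 : ℤ) * z)

theorem f_one (hq : q ≠ 0) (h : q ^ 24 ≠ 1) :
    f q 1 = (q ^ 8 * g1Denom q 1) • (1 : Matrix (Fin 3) (Fin 3) K) := by
  have h3 := pow_four_add_sq_add_one_ne_zero h
  have hα := alpha_eq hq h
  have hβ := beta_eq hq h
  obtain ⟨t, ht⟩ : ∃ t, t = q ^ 4 + q ^ 2 + 1 := ⟨_, rfl⟩
  rw [← ht] at h3 hα hβ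
  ext i j
  fin_cases i <;> fin_cases j <;>
    simp [f, g1Denom, zpow_neg, zpow_ofNat, hα, hβ] <;> field_simp <;> rw [ht] <;> ring

theorem f_mul_f_inv (hq : q ≠ 0) (h : q ^ 24 ≠ 1) (hz : z ≠ 0) :
    f q z * f q z⁻¹ =
      (q ^ 16 * (g1Denom q z * g1Denom q z⁻¹)) • (1 : Matrix (Fin 3) (Fin 3) K) := by
  have h3 := pow_four_add_sq_add_one_ne_zero h
  have hα := alpha_eq hq h
  have hβ := beta_eq hq h
  have hγ := gam_eq hq h
  obtain ⟨t, ht⟩ : ∃ t, t = q ^ 4 + q ^ 2 + 1 := ⟨_, rfl⟩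
  rw [← ht] at h3 hα hβ hγ
  ext i j
  fin_cases i <;> fin_cases j <;>
    simp [f, g1Denom, Matrix.mul_apply, Fin.sum_univ_three, zpow_neg, zpow_ofNat] <;>
    simp only [hα, hβ, hγ] <;> field_simp <;> rw [ht] <;> ring

theorem g1Denom_one_ne_zero (hq : q ≠ 0) (h : q ^ 24 ≠ 1) : g1Denom q 1 ≠ 0 := by
  simp only [g1Denom, mul_one]
  refine mul_ne_zero (mul_ne_zero ?_ ?_) ?_ <;> intro h0
  · refine pow_ne_one_of_dvd (n := 2) h (by decide) ?_
    rw [zpow_neg, ← Nat.cast_ofNat, zpow_natCast] at h0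
    field_simp at h0
    linear_combination h0
  · refine pow_ne_one_of_dvd (n := 12) h (by decide) ?_
    rw [zpow_neg, ← Nat.cast_ofNat, zpow_natCast] at h0
    field_simp at h0
    linear_combination (q ^ 6 - 1) * h0
  · refine pow_ne_one_of_dvd (n := 8) h (by decide) ?_
    rw [zpow_neg, ← Nat.cast_ofNat, zpow_natCast] at h0
    field_simp at h0
    linear_combination h0

theorem g1_one (hq : q ≠ 0) (h : q ^ 24 ≠ 1) : g1 q 1 = 1 := by
  have hd := g1Denom_one_ne_zero hq h
  have e8 : q ^ (8 : ℤ) = q ^ 8 := by norm_cast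
  rw [g1, f_one hq h, ← g1Denom, smul_smul, zpow_neg, e8]
  convert one_smul K _
  field_simp

theorem g1_mul_g1_inv (hq : q ≠ 0) (h : q ^ 24 ≠ 1) (hz : z ≠ 0) (hd : g1Denom q z ≠ 0)
    (hd' : g1Denom q z⁻¹ ≠ 0) : g1 q z * g1 q z⁻¹ = 1 := by
  have e8 : q ^ (8 : ℤ) = q ^ 8 := by norm_cast
  rw [g1, g1, smul_mul_smul_comm, f_mul_f_inv hq h hz, ← g1Denom, ← g1Denom, smul_smul, zpow_neg,
    e8]
  convert one_smul K _
  generalize g1Denom q z⁻¹ = d at hd'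
  field_simp

end Field

theorem q_ne_zero : q ≠ 0 := by
  rw [q, map_ne_zero]
  exact RatFunc.X_ne_zero

theorem q_zpow (n : ℤ) : q ^ n = RatFunc.C ((RatFunc.X : RatFunc ℂ) ^ n) := by
  rw [q, map_zpow₀]

theorem q_pow_ne_one : q ^ 24 ≠ 1 := by
  rw [q, ← map_pow, ← map_one RatFunc.C, RatFunc.C_injective.ne_iff, ← RatFunc.algebraMap_X,
    ← map_pow, ← map_one (algebraMap (Polynomial ℂ) (RatFunc ℂ)),
    (RatFunc.algebraMap_injective ℂ).ne_iff]
  intro h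
  simpa using congrArg Polynomial.natDegree h

theorem zvar_ne_C (c : RatFunc ℂ) : zvar ≠ RatFunc.C c := by
  rw [zvar, ← RatFunc.algebraMap_X, ← RatFunc.algebraMap_C,
    (RatFunc.algebraMap_injective (RatFunc ℂ)).ne_iff]
  exact Polynomial.X_ne_C c

theorem one_sub_C_mul_zvar_ne_zero (c : RatFunc ℂ) : 1 - RatFunc.C c * zvar ≠ 0 := by
  intro h
  apply zvar_ne_C c⁻¹
  rw [map_inv₀]
  exact eq_inv_of_mul_eq_one_right (by linear_combination -h)

theorem one_sub_C_mul_zvar_inv_ne_zero (c : RatFunc ℂ) : 1 - RatFunc.C c * zvar⁻¹ ≠ 0 := by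
  have hz : zvar ≠ 0 := by simpa using zvar_ne_C 0
  intro h
  apply zvar_ne_C c
  field_simp at h
  linear_combination h

theorem g1Denom_zvar_ne_zero : g1Denom q zvar ≠ 0 := by
  have h (c : RatFunc ℂ) := one_sub_C_mul_zvar_ne_zero c
  simp only [g1Denom, q_zpow]
  refine mul_ne_zero (mul_ne_zero (h _) ?_) (h _)
  simpa only [map_neg, neg_mul, sub_neg_eq_add] using h (-RatFunc.X ^ (-6 : ℤ))

theorem g1Denom_zvar_inv_ne_zero : g1Denom q zvar⁻¹ ≠ 0 := by
  have h (c : RatFunc ℂ) := one_sub_C_mul_zvar_inv_ne_zero c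
  simp only [g1Denom, q_zpow]
  refine mul_ne_zero (mul_ne_zero (h _) ?_) (h _)
  simpa only [map_neg, neg_mul, sub_neg_eq_add] using h (-RatFunc.X ^ (-6 : ℤ))

/-- `g₁(1) = Id` and the inversion relation `g₁(z)g₁(z⁻¹) = Id` for type E₆^{(2)}. -/
theorem E62_g1_properties :
    g1 q (1 : F) = 1 ∧ g1 q zvar * g1 q zvar⁻¹ = 1 :=
  ⟨g1_one q_ne_zero q_pow_ne_one,
    g1_mul_g1_inv q_ne_zero q_pow_ne_one (by simpa using zvar_ne_C 0) g1Denom_zvar_ne_zero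
      g1Denom_zvar_inv_ne_zero⟩

end
end Stmt14
end

section
/- The 3×3 multiplicity block g₁(z) of the R-matrix of type E₆^{(2)}, evaluated at z = q^{−2} (which is a regular point of all its entries), is a matrix over ℂ(q) of rank exactly 1. -/
open scoped Kronecker Matrix

set_option maxHeartbeats 1000000
set_option synthInstance.maxHeartbeats 1000000

namespace Stmt15

noncomputable section

/-- the quantum number `[n]_k = (q^{kn} - q^{-kn})/(q^k - q^{-k})`. -/
def qnum {F : Type*} [Field F] (q : F) (n k : ℤ) : F :=
  (q ^ (k * n) - q ^ (-(k * n))) / (q ^ k - q ^ (-k))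

/-- the quantum number `[n]_kⁱ = (q^{kn} + (-1)^{n-1} q^{-kn})/(q^k + q^{-k})`. -/
def qnumi {F : Type*} [Field F] (q : F) (n k : ℤ) : F :=
  (q ^ (k * n) + (-1 : F) ^ (n - 1) * q ^ (-(k * n))) / (q ^ k + q ^ (-k))

/-- `α = [2]ⁱ·([3] - [2]₆)/[3]`. -/
def alpha {F : Type*} [Field F] (q : F) : F :=
  qnumi q 2 1 * (qnum q 3 1 - qnum q 2 6) / qnum q 3 1

/-- `β = [2]ⁱ·[4]/[3]`. -/
def beta {F : Type*} [Field F] (q : F) : F := qnumi q 2 1 * qnum q 4 1 / qnum q 3 1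

/-- `γ = [2]ⁱ·[2]·[2]₆·[7]/[3]`. -/
def gam {F : Type*} [Field F] (q : F) : F :=
  qnumi q 2 1 * qnum q 2 1 * qnum q 2 6 * qnum q 7 1 / qnum q 3 1

/-- the matrix `f_{ω₁}(z)` of type E₆^{(2)}. -/
def f {F : Type*} [Field F] (q z : F) : Matrix (Fin 3) (Fin 3) F :=
  !![(q ^ (-3 : ℤ) - q ^ (3 : ℤ) * z) * (q ^ (-3 : ℤ) + alpha q * z - q ^ (3 : ℤ) * z ^ 2),
      beta q * z * (1 - z), beta q * z * (1 - z);
    gam q * z * (1 - z), beta q * z * (q ^ (6 : ℤ) - q ^ (-6 : ℤ) * z),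
      (1 - z) * (q ^ (6 : ℤ) + beta q * z - q ^ (-6 : ℤ) * z ^ 2);
    gam q * z * (1 - z), (1 - z) * (q ^ (6 : ℤ) + beta q * z - q ^ (-6 : ℤ) * z ^ 2),
      beta q * z * (q ^ (6 : ℤ) - q ^ (-6 : ℤ) * z)]

/-- the 3×3 multiplicity block `g₁(z)` of the R-matrix of type E₆^{(2)}
on the multiplicity space of the summand `L_{ω₁}`. -/
def g1 {F : Type*} [Field F] (q z : F) : Matrix (Fin 3) (Fin 3) F :=
  (q ^ (-8 : ℤ) /
      ((1 - q ^ (-2 : ℤ) * z) * (1 + q ^ (-6 : ℤ) * z) * (1 - q ^ (-8 : ℤ) * z))) • f q z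

/-- The common ratio of the lower rows of `f q (q⁻²)` to its first row, `q⁻⁶ + q⁻⁴ + ⋯ + q⁶`. -/
def rowRatio {F : Type*} [Field F] (q : F) : F :=
  (q ^ 12 + q ^ 10 + q ^ 8 + q ^ 6 + q ^ 4 + q ^ 2 + 1) / q ^ 6

section NotRootOfUnity

variable {F : Type*} [Field F] {q : F}

lemma sq_add_one_ne_zero (hq : ∀ n : ℕ, 0 < n → q ^ n ≠ 1) : q ^ 2 + 1 ≠ 0 := fun h =>
  hq 4 (by norm_num) (by linear_combination (q ^ 2 - 1) * h)

lemma sq_sub_one_ne_zero (hq : ∀ n : ℕ, 0 < n → q ^ n ≠ 1) : q ^ 2 - 1 ≠ 0 :=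
  sub_ne_zero.2 (hq 2 (by norm_num))

lemma q4_add_q2_add_one_ne_zero (hq : ∀ n : ℕ, 0 < n → q ^ n ≠ 1) : q ^ 4 + q ^ 2 + 1 ≠ 0 :=
  fun h => hq 6 (by norm_num) (by linear_combination (q ^ 2 - 1) * h)

lemma qnumi_two_one (h0 : q ≠ 0) (hq : ∀ n : ℕ, 0 < n → q ^ n ≠ 1) :
    qnumi q 2 1 = (q ^ 2 - 1) / q := by
  have h := sq_add_one_ne_zero hq
  have h1 : q + q ^ (-1 : ℤ) = (q ^ 2 + 1) / q := by
    simp only [zpow_neg, zpow_one]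
    field_simp
  have h2 : q ^ (2 : ℤ) + (-1) ^ ((2 : ℤ) - 1) * q ^ (-2 : ℤ) = (q ^ 4 - 1) / q ^ 2 := by
    norm_num only [zpow_neg, zpow_ofNat, zpow_one]
    field_simp
    ring
  rw [qnumi, one_mul, zpow_one, h1, h2]
  field_simp
  ring

lemma qnum_one_eq (h0 : q ≠ 0) (n : ℕ) :
    qnum q n 1 = (q ^ (2 * n) - 1) * q / (q ^ n * (q ^ 2 - 1)) := by
  have : q - q⁻¹ = (q ^ 2 - 1) / q := by field_simp
  simp only [qnum, one_mul, zpow_neg, zpow_natCast, zpow_one, this, pow_mul']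
  field_simp

lemma qnum_three_one (h0 : q ≠ 0) (hq : ∀ n : ℕ, 0 < n → q ^ n ≠ 1) :
    qnum q 3 1 = (q ^ 4 + q ^ 2 + 1) / q ^ 2 := by
  have h := sq_sub_one_ne_zero hq
  rw [show (3 : ℤ) = (3 : ℕ) from rfl, qnum_one_eq h0]
  field_simp
  ring

lemma qnum_two_six (h0 : q ≠ 0) (hq : ∀ n : ℕ, 0 < n → q ^ n ≠ 1) :
    qnum q 2 6 = (q ^ 12 + 1) / q ^ 6 := by
  have h : q ^ 12 - 1 ≠ 0 := sub_ne_zero.2 (hq 12 (by norm_num))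
  have h6 : q ^ (6 : ℤ) - q ^ (-6 : ℤ) = (q ^ 12 - 1) / q ^ 6 := by
    simp only [zpow_neg, zpow_ofNat]
    field_simp
  have h12 : q ^ ((6 : ℤ) * 2) - q ^ (-((6 : ℤ) * 2)) = (q ^ 24 - 1) / q ^ 12 := by
    norm_num only [zpow_neg, zpow_ofNat]
    field_simp
  rw [qnum, h6, h12, div_div_div_eq, div_eq_div_iff (by positivity) (by positivity)]
  ring

lemma alpha_eq (h0 : q ≠ 0) (hq : ∀ n : ℕ, 0 < n → q ^ n ≠ 1) :
    alpha q = (q ^ 2 - 1) * (q ^ 8 + q ^ 6 + q ^ 4 - q ^ 12 - 1) /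
      (q ^ 5 * (q ^ 4 + q ^ 2 + 1)) := by
  have h := q4_add_q2_add_one_ne_zero hq
  rw [alpha, qnumi_two_one h0 hq, qnum_three_one h0 hq, qnum_two_six h0 hq]
  field_simp
  ring

lemma beta_eq (h0 : q ≠ 0) (hq : ∀ n : ℕ, 0 < n → q ^ n ≠ 1) :
    beta q = (q ^ 8 - 1) / (q ^ 2 * (q ^ 4 + q ^ 2 + 1)) := by
  have h := q4_add_q2_add_one_ne_zero hq
  have h' := sq_sub_one_ne_zero hq
  rw [beta, qnumi_two_one h0 hq, qnum_three_one h0 hq,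
    show (4 : ℤ) = (4 : ℕ) from rfl, qnum_one_eq h0]
  field_simp

lemma gam_eq (h0 : q ≠ 0) (hq : ∀ n : ℕ, 0 < n → q ^ n ≠ 1) :
    gam q = (q ^ 4 - 1) * (q ^ 12 + 1) * (q ^ 14 - 1) /
      (q ^ 12 * (q ^ 2 - 1) * (q ^ 4 + q ^ 2 + 1)) := by
  have h := q4_add_q2_add_one_ne_zero hq
  have h' := sq_sub_one_ne_zero hq
  rw [gam, qnumi_two_one h0 hq, qnum_three_one h0 hq, qnum_two_six h0 hq,
    show (2 : ℤ) = (2 : ℕ) from rfl, show (7 : ℤ) = (7 : ℕ) from rfl,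
    qnum_one_eq h0, qnum_one_eq h0]
  field_simp

lemma f_eq_vecMulVec (h0 : q ≠ 0) (hq : ∀ n : ℕ, 0 < n → q ^ n ≠ 1) :
    f q (q ^ (-2 : ℤ)) = Matrix.vecMulVec ![1, rowRatio q, rowRatio q] (f q (q ^ (-2 : ℤ)) 0) := by
  have h := q4_add_q2_add_one_ne_zero hq
  have h' := sq_sub_one_ne_zero hq
  have h'' : q ^ 2 * (q ^ 2 + 1) + 1 ≠ 0 := by convert h using 1; ring
  ext i j
  fin_cases i <;> fin_cases j <;>
    simp [f, Matrix.vecMulVec_apply, rowRatio, alpha_eq h0 hq, beta_eq h0 hq, gam_eq h0 hq,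
      zpow_neg, zpow_ofNat] <;> field_simp <;> ring

lemma f_zero_one_ne_zero (h0 : q ≠ 0) (hq : ∀ n : ℕ, 0 < n → q ^ n ≠ 1) :
    f q (q ^ (-2 : ℤ)) 0 1 ≠ 0 := by
  have h := q4_add_q2_add_one_ne_zero hq
  have h2 := sq_sub_one_ne_zero hq
  have h8 : q ^ 8 - 1 ≠ 0 := sub_ne_zero.2 (hq 8 (by norm_num))
  have : f q (q ^ (-2 : ℤ)) 0 1 =
      (q ^ 8 - 1) * (q ^ 2 - 1) / (q ^ 6 * (q ^ 4 + q ^ 2 + 1)) := by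
    simp [f, beta_eq h0 hq, zpow_neg, zpow_ofNat]
    field_simp
  rw [this]
  positivity

lemma rank_f_eq_one (h0 : q ≠ 0) (hq : ∀ n : ℕ, 0 < n → q ^ n ≠ 1) :
    (f q (q ^ (-2 : ℤ))).rank = 1 := by
  refine le_antisymm ?_ (Nat.one_le_iff_ne_zero.2 fun h => f_zero_one_ne_zero h0 hq ?_)
  · rw [f_eq_vecMulVec h0 hq]
    exact Matrix.rank_vecMulVec_le _ _
  · rw [Matrix.rank, Module.finrank_eq_zero_iff_of_free] at h
    have := LinearMap.range_eq_bot.1 (Submodule.subsingleton_iff_eq_bot.1 h)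
    have := congrFun (LinearMap.congr_fun this (Pi.single 1 1)) 0
    simpa using this

lemma g1_scalar_ne_zero (h0 : q ≠ 0) (hq : ∀ n : ℕ, 0 < n → q ^ n ≠ 1) :
    q ^ (-8 : ℤ) / ((1 - q ^ (-2 : ℤ) * q ^ (-2 : ℤ)) * (1 + q ^ (-6 : ℤ) * q ^ (-2 : ℤ)) *
      (1 - q ^ (-8 : ℤ) * q ^ (-2 : ℤ))) ≠ 0 := by
  have h4 : q ^ 4 - 1 ≠ 0 := sub_ne_zero.2 (hq 4 (by norm_num))
  have h8 : q ^ 8 + 1 ≠ 0 := fun h =>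
    hq 16 (by norm_num) (by linear_combination (q ^ 8 - 1) * h)
  have h10 : q ^ 10 - 1 ≠ 0 := sub_ne_zero.2 (hq 10 (by norm_num))
  have e4 : 1 - q ^ (-2 : ℤ) * q ^ (-2 : ℤ) = (q ^ 4 - 1) / q ^ 4 := by
    simp only [zpow_neg, zpow_ofNat]
    field_simp
  have e8 : 1 + q ^ (-6 : ℤ) * q ^ (-2 : ℤ) = (q ^ 8 + 1) / q ^ 8 := by
    simp only [zpow_neg, zpow_ofNat]
    field_simp
  have e10 : 1 - q ^ (-8 : ℤ) * q ^ (-2 : ℤ) = (q ^ 10 - 1) / q ^ 10 := by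
    simp only [zpow_neg, zpow_ofNat]
    field_simp
  rw [e4, e8, e10]
  positivity

/-- If `q` is neither zero nor a root of unity, then `g₁(q⁻²)` has rank one. -/
lemma rank_g1_eq_one (h0 : q ≠ 0) (hq : ∀ n : ℕ, 0 < n → q ^ n ≠ 1) :
    (g1 q (q ^ (-2 : ℤ))).rank = 1 := by
  rw [g1, Matrix.rank_smul_of_mem_nonZeroDivisors _
    (mem_nonZeroDivisors_of_ne_zero (g1_scalar_ne_zero h0 hq)), rank_f_eq_one h0 hq]

end NotRootOfUnity

lemma RatFunc_X_pow_ne_one (n : ℕ) (hn : 0 < n) : (RatFunc.X : RatFunc ℂ) ^ n ≠ 1 := by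
  intro h
  refine RatFunc.transcendental_X (K := ℂ) ⟨Polynomial.X ^ n - 1, ?_, ?_⟩
  · exact (Polynomial.monic_X_pow_sub_C 1 hn.ne').ne_zero
  · simp [h]

/-- The 3×3 multiplicity block `g₁(z)` of the R-matrix of type E₆^{(2)},
evaluated at `z = q⁻²`, has rank exactly 1 (as a matrix over `ℂ(q)`). -/
theorem E62_g1_rank_one :
    (g1 (RatFunc.X : RatFunc ℂ) ((RatFunc.X : RatFunc ℂ) ^ (-2 : ℤ))).rank = 1 :=
  rank_g1_eq_one RatFunc.X_ne_zero RatFunc_X_pow_ne_one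

end
end Stmt15
end

section
/- The 2×2 multiplicity block g₂(z) of the R-matrix of type E₆^{(2)} on the two-dimensional multiplicity space of the trivial summand L_{ω₀} satisfies g₂(1) = Id₂, the inversion relation g₂(z)·g₂(z⁻¹) = Id₂, and g₂(0) = diag(q^{−26}, q^{−2}). -/
open scoped Kronecker Matrix

set_option maxHeartbeats 1000000
set_option synthInstance.maxHeartbeats 1000000

namespace Stmt16

noncomputable section

/-- the quantum number `[n]_k = (q^{kn} - q^{-kn})/(q^k - q^{-k})`. -/
def qnum {F : Type*} [Field F] (q : F) (n k : ℤ) : F :=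
  (q ^ (k * n) - q ^ (-(k * n))) / (q ^ k - q ^ (-k))

/-- the quantum number `[n]_kⁱ = (q^{kn} + (-1)^{n-1} q^{-kn})/(q^k + q^{-k})`. -/
def qnumi {F : Type*} [Field F] (q : F) (n k : ℤ) : F :=
  (q ^ (k * n) + (-1 : F) ^ (n - 1) * q ^ (-(k * n))) / (q ^ k + q ^ (-k))

abbrev F : Type := RatFunc (RatFunc ℂ)

def q : F := RatFunc.C RatFunc.X

/-- the spectral variable `z` -/
def zvar : F := RatFunc.X

/-- `ζ = [2]ⁱ·[2]·[7]/[3]`. -/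
def zeta : F := qnumi q 2 1 * qnum q 2 1 * qnum q 7 1 / qnum q 3 1

/-- `ξ = [2]₁₄ - [2]₁₂ - [2]₆ + [2]₄ - 2`. -/
def xi : F := qnum q 2 14 - qnum q 2 12 - qnum q 2 6 + qnum q 2 4 - 2

/-- `η = [2]ⁱ·[4]/[3]`. -/
def eta : F := qnumi q 2 1 * qnum q 4 1 / qnum q 3 1

/-- `ρ = [2]ⁱ·[3]₃ⁱ·[2]₄·[4]·[13]/[3]`. -/
def rho : F := qnumi q 2 1 * qnumi q 3 3 * qnum q 2 4 * qnum q 4 1 * qnum q 13 1 / qnum q 3 1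

/-- the matrix `f_{ω₀}(z)` of type E₆^{(2)}. -/
def f (z : F) : Matrix (Fin 2) (Fin 2) F :=
  !![q ^ (-12 : ℤ) + q ^ (-6 : ℤ) * zeta * z + xi * z ^ 2 - q ^ (6 : ℤ) * zeta * z ^ 3
        + q ^ (12 : ℤ) * z ^ 4,
      eta * z * (1 - z ^ 2);
    rho * z * (1 - z ^ 2),
      q ^ (12 : ℤ) - q ^ (6 : ℤ) * zeta * z + xi * z ^ 2 + q ^ (-6 : ℤ) * zeta * z ^ 3
        + q ^ (-12 : ℤ) * z ^ 4]

/-- the 2×2 multiplicity block `g₂(z)` of the R-matrix of type E₆^{(2)}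
on the multiplicity space of the trivial summand `L_{ω₀}`. -/
def g2 (z : F) : Matrix (Fin 2) (Fin 2) F :=
  (q ^ (-14 : ℤ) /
      ((1 - q ^ (-2 : ℤ) * z) * (1 + q ^ (-6 : ℤ) * z) * (1 - q ^ (-8 : ℤ) * z) *
        (1 + q ^ (-12 : ℤ) * z))) • f z

section Field

variable {K : Type*} [Field K] {x : K}

theorem pow_sub_one_ne_zero (hq : ∀ n : ℕ, n ≠ 0 → x ^ n ≠ 1) {n : ℕ} (hn : n ≠ 0) :
    x ^ n - 1 ≠ 0 :=
  sub_ne_zero.2 (hq n hn)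

theorem pow_ne_neg_one (hq : ∀ n : ℕ, n ≠ 0 → x ^ n ≠ 1) {n : ℕ} (hn : n ≠ 0) :
    x ^ n ≠ -1 := by
  intro h
  apply hq (n * 2) (by omega)
  rw [pow_mul, h]
  norm_num

theorem pow_add_one_ne_zero (hq : ∀ n : ℕ, n ≠ 0 → x ^ n ≠ 1) {n : ℕ} (hn : n ≠ 0) :
    x ^ n + 1 ≠ 0 := fun h =>
  pow_ne_neg_one hq hn (eq_neg_of_add_eq_zero_left h)

theorem pow_four_add_sq_add_one_ne_zero (hq : ∀ n : ℕ, n ≠ 0 → x ^ n ≠ 1) :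
    x ^ 4 + x ^ 2 + 1 ≠ 0 := fun h =>
  pow_sub_one_ne_zero hq (n := 6) (by norm_num) (by linear_combination (x ^ 2 - 1) * h)

theorem qnum_eq (hx : x ≠ 0) (n k : ℕ) (hn : n ≠ 0) (hk : x ^ (2 * k) - 1 ≠ 0) :
    qnum x n k = (x ^ (2 * k * n) - 1) / (x ^ (k * (n - 1)) * (x ^ (2 * k) - 1)) := by
  obtain ⟨m, rfl⟩ := Nat.exists_eq_succ_of_ne_zero hn
  have e1 : x ^ ((k : ℤ) * ((m + 1 : ℕ) : ℤ)) = x ^ (k * (m + 1)) := by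
    rw [← zpow_natCast]; push_cast; rfl
  have e2 : x ^ (k : ℤ) - (x ^ (k : ℤ))⁻¹ = (x ^ (2 * k) - 1) / x ^ k := by
    rw [zpow_natCast]; field_simp; ring
  simp only [qnum, zpow_neg, Nat.succ_eq_add_one]
  rw [e1, e2, Nat.add_sub_cancel]
  field_simp
  ring

theorem qnumi_eq (hx : x ≠ 0) (n k : ℕ) (hn : n ≠ 0) (hk : x ^ (2 * k) + 1 ≠ 0) :
    qnumi x n k =
      (x ^ (2 * k * n) + (-1) ^ (n - 1)) / (x ^ (k * (n - 1)) * (x ^ (2 * k) + 1)) := by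
  obtain ⟨m, rfl⟩ := Nat.exists_eq_succ_of_ne_zero hn
  have e1 : x ^ ((k : ℤ) * ((m + 1 : ℕ) : ℤ)) = x ^ (k * (m + 1)) := by
    rw [← zpow_natCast]; push_cast; rfl
  have e2 : x ^ (k : ℤ) + (x ^ (k : ℤ))⁻¹ = (x ^ (2 * k) + 1) / x ^ k := by
    rw [zpow_natCast]; field_simp; ring
  have e3 : (-1 : K) ^ (((m + 1 : ℕ) : ℤ) - 1) = (-1) ^ m := by
    rw [← zpow_natCast]; push_cast; simp
  simp only [qnumi, zpow_neg, Nat.succ_eq_add_one]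
  rw [e1, e2, e3, Nat.add_sub_cancel]
  field_simp
  ring

theorem qnum_two (hx : x ≠ 0) (hq : ∀ n : ℕ, n ≠ 0 → x ^ n ≠ 1) {k : ℕ} (hk : k ≠ 0) :
    qnum x 2 k = (x ^ (2 * k) + 1) / x ^ k := by
  have h := pow_sub_one_ne_zero hq (n := 2 * k) (by omega)
  have e := qnum_eq hx 2 k (by norm_num) h
  norm_num at e
  rw [e]
  field_simp
  ring

theorem qnum_three (hx : x ≠ 0) (hq : ∀ n : ℕ, n ≠ 0 → x ^ n ≠ 1) :
    qnum x 3 1 = (x ^ 6 - 1) / (x ^ 2 * (x ^ 2 - 1)) := by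
  simpa using qnum_eq hx 3 1 (by norm_num) (pow_sub_one_ne_zero hq (by norm_num))

theorem qnumi_two (hx : x ≠ 0) (hq : ∀ n : ℕ, n ≠ 0 → x ^ n ≠ 1) :
    qnumi x 2 1 = (x ^ 2 - 1) / x := by
  have h := pow_add_one_ne_zero hq (n := 2) (by norm_num)
  have e := qnumi_eq hx 2 1 (by norm_num) h
  norm_num at e
  rw [e]
  field_simp
  ring

theorem zeta_formula (hx : x ≠ 0) (hq : ∀ n : ℕ, n ≠ 0 → x ^ n ≠ 1) :
    qnumi x 2 1 * qnum x 2 1 * qnum x 7 1 / qnum x 3 1 =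
      (x ^ 4 - 1) * (x ^ 14 - 1) / (x ^ 6 * (x ^ 6 - 1)) := by
  have h := pow_sub_one_ne_zero hq (n := 2) (by norm_num)
  have h6 := pow_sub_one_ne_zero hq (n := 6) (by norm_num)
  have e := qnum_eq hx 7 1 (by norm_num) h
  have e2 := qnum_two hx hq (k := 1) (by norm_num)
  norm_num at e e2
  rw [qnumi_two hx hq, qnum_three hx hq, e, e2]
  field_simp
  ring

theorem xi_formula (hx : x ≠ 0) (hq : ∀ n : ℕ, n ≠ 0 → x ^ n ≠ 1) :
    qnum x 2 14 - qnum x 2 12 - qnum x 2 6 + qnum x 2 4 - 2 =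
      (x ^ 28 + 1) / x ^ 14 - (x ^ 24 + 1) / x ^ 12 - (x ^ 12 + 1) / x ^ 6
        + (x ^ 8 + 1) / x ^ 4 - 2 := by
  have e14 := qnum_two hx hq (k := 14) (by norm_num)
  have e12 := qnum_two hx hq (k := 12) (by norm_num)
  have e6 := qnum_two hx hq (k := 6) (by norm_num)
  have e4 := qnum_two hx hq (k := 4) (by norm_num)
  norm_num at e14 e12 e6 e4
  rw [e14, e12, e6, e4]

theorem eta_formula (hx : x ≠ 0) (hq : ∀ n : ℕ, n ≠ 0 → x ^ n ≠ 1) :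
    qnumi x 2 1 * qnum x 4 1 / qnum x 3 1 =
      (x ^ 2 - 1) * (x ^ 8 - 1) / (x ^ 2 * (x ^ 6 - 1)) := by
  have h := pow_sub_one_ne_zero hq (n := 2) (by norm_num)
  have h6 := pow_sub_one_ne_zero hq (n := 6) (by norm_num)
  have e := qnum_eq hx 4 1 (by norm_num) h
  norm_num at e
  rw [qnumi_two hx hq, qnum_three hx hq, e]
  field_simp

theorem rho_formula (hx : x ≠ 0) (hq : ∀ n : ℕ, n ≠ 0 → x ^ n ≠ 1) :
    qnumi x 2 1 * qnumi x 3 3 * qnum x 2 4 * qnum x 4 1 * qnum x 13 1 / qnum x 3 1 =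
      (x ^ 12 - x ^ 6 + 1) * (x ^ 8 + 1) * (x ^ 8 - 1) * (x ^ 26 - 1) /
        (x ^ 24 * (x ^ 6 - 1)) := by
  have h := pow_sub_one_ne_zero hq (n := 2) (by norm_num)
  have h6 := pow_sub_one_ne_zero hq (n := 6) (by norm_num)
  have hp := pow_add_one_ne_zero hq (n := 6) (by norm_num)
  have e := qnum_eq hx 4 1 (by norm_num) h
  have e13 := qnum_eq hx 13 1 (by norm_num) h
  have e3 := qnumi_eq hx 3 3 (by norm_num) hp
  have e4 := qnum_two hx hq (k := 4) (by norm_num)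
  norm_num at e e13 e3 e4
  rw [qnumi_two hx hq, qnum_three hx hq, e, e13, e3, e4]
  field_simp
  ring

/-- The matrix `f` with parameters in an arbitrary field. -/
def fMatrix (x ζ ξ η ρ z : K) : Matrix (Fin 2) (Fin 2) K :=
  !![x ^ (-12 : ℤ) + x ^ (-6 : ℤ) * ζ * z + ξ * z ^ 2 - x ^ (6 : ℤ) * ζ * z ^ 3
        + x ^ (12 : ℤ) * z ^ 4,
      η * z * (1 - z ^ 2);
    ρ * z * (1 - z ^ 2),
      x ^ (12 : ℤ) - x ^ (6 : ℤ) * ζ * z + ξ * z ^ 2 + x ^ (-6 : ℤ) * ζ * z ^ 3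
        + x ^ (-12 : ℤ) * z ^ 4]

/-- The denominator of `g₂` over an arbitrary field. -/
def denom (x z : K) : K :=
  (1 - x ^ (-2 : ℤ) * z) * (1 + x ^ (-6 : ℤ) * z) * (1 - x ^ (-8 : ℤ) * z) *
    (1 + x ^ (-12 : ℤ) * z)

/-- The matrix `g₂` over an arbitrary field. -/
def gMatrix (x z : K) : Matrix (Fin 2) (Fin 2) K :=
  (x ^ (-14 : ℤ) / denom x z) • fMatrix x
    (qnumi x 2 1 * qnum x 2 1 * qnum x 7 1 / qnum x 3 1)
    (qnum x 2 14 - qnum x 2 12 - qnum x 2 6 + qnum x 2 4 - 2)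
    (qnumi x 2 1 * qnum x 4 1 / qnum x 3 1)
    (qnumi x 2 1 * qnumi x 3 3 * qnum x 2 4 * qnum x 4 1 * qnum x 13 1 / qnum x 3 1) z

theorem denom_ne_zero (hx : x ≠ 0) {z : K}
    (h : ∀ n : ℕ, n ≠ 0 → z ≠ x ^ n ∧ z ≠ -x ^ n) : denom x z ≠ 0 := by
  have hsub (n : ℕ) (hn : n ≠ 0) : 1 - x ^ (-(n : ℤ)) * z ≠ 0 := by
    intro e
    apply (h n hn).1
    rw [zpow_neg, zpow_natCast] at e
    field_simp at e
    linear_combination -e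
  have hadd (n : ℕ) (hn : n ≠ 0) : 1 + x ^ (-(n : ℤ)) * z ≠ 0 := by
    intro e
    apply (h n hn).2
    rw [zpow_neg, zpow_natCast] at e
    field_simp at e
    linear_combination e
  exact mul_ne_zero (mul_ne_zero (mul_ne_zero (hsub 2 (by norm_num)) (hadd 6 (by norm_num)))
    (hsub 8 (by norm_num))) (hadd 12 (by norm_num))

theorem denom_one_ne_zero (hx : x ≠ 0) (hq : ∀ n : ℕ, n ≠ 0 → x ^ n ≠ 1) : denom x 1 ≠ 0 :=
  denom_ne_zero hx fun n hn => ⟨(hq n hn).symm, fun h =>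
    pow_ne_neg_one hq hn (by rw [h, neg_neg])⟩

theorem denom_mul (hx : x ≠ 0) (z : K) :
    denom x z * x ^ 28 = (x ^ 2 - z) * (x ^ 6 + z) * (x ^ 8 - z) * (x ^ 12 + z) := by
  simp only [denom, zpow_neg, zpow_ofNat]
  field_simp

theorem gMatrix_one (hx : x ≠ 0) (hq : ∀ n : ℕ, n ≠ 0 → x ^ n ≠ 1) : gMatrix x 1 = 1 := by
  have h6 := pow_sub_one_ne_zero hq (n := 6) (by norm_num)
  have hd := denom_one_ne_zero hx hq
  have hm := denom_mul hx 1
  rw [gMatrix, zeta_formula hx hq, xi_formula hx hq]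
  have hd' : denom x 1 = (x ^ 2 - 1) * (x ^ 6 + 1) * (x ^ 8 - 1) * (x ^ 12 + 1) / x ^ 28 := by
    field_simp
    exact hm
  ext i j
  fin_cases i <;> fin_cases j <;> simp [fMatrix, zpow_neg, zpow_ofNat]
  all_goals
    rw [div_mul_eq_mul_div, div_eq_one_iff_eq hd, hd']
    field_simp
    ring

theorem gMatrix_zero (hx : x ≠ 0) :
    gMatrix x 0 = !![x ^ (-26 : ℤ), 0; 0, x ^ (-2 : ℤ)] := by
  ext i j
  fin_cases i <;> fin_cases j <;> simp [gMatrix, fMatrix, denom, zpow_neg, zpow_ofNat] <;> field_simp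

theorem fMatrix_mul_fMatrix_inv (hx : x ≠ 0) (hq : ∀ n : ℕ, n ≠ 0 → x ^ n ≠ 1) {ζ ξ η ρ z : K}
    (hζ : ζ = (x ^ 4 - 1) * (x ^ 14 - 1) / (x ^ 6 * (x ^ 6 - 1)))
    (hξ : ξ = (x ^ 28 + 1) / x ^ 14 - (x ^ 24 + 1) / x ^ 12 - (x ^ 12 + 1) / x ^ 6
        + (x ^ 8 + 1) / x ^ 4 - 2)
    (hη : η = (x ^ 2 - 1) * (x ^ 8 - 1) / (x ^ 2 * (x ^ 6 - 1)))
    (hρ : ρ = (x ^ 12 - x ^ 6 + 1) * (x ^ 8 + 1) * (x ^ 8 - 1) * (x ^ 26 - 1) /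
        (x ^ 24 * (x ^ 6 - 1)))
    (hz : z ≠ 0) :
    fMatrix x ζ ξ η ρ z * fMatrix x ζ ξ η ρ z⁻¹ = (x ^ 28 * denom x z * denom x z⁻¹) • 1 := by
  have h6 := pow_sub_one_ne_zero hq (n := 6) (by norm_num)
  ext i j
  fin_cases i <;> fin_cases j <;>
    simp only [fMatrix, denom, Matrix.mul_apply, Fin.sum_univ_two, zpow_neg, zpow_ofNat,
      Fin.zero_eta, Fin.mk_one, Matrix.of_apply, Matrix.cons_val', Matrix.cons_val_zero,
      Matrix.cons_val_one, Matrix.cons_val_fin_one, Matrix.smul_apply, Matrix.one_apply_eq,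
      smul_eq_mul, mul_one, ne_eq, zero_ne_one, one_ne_zero, not_false_eq_true,
      Matrix.one_apply_ne, mul_zero]
  · subst hζ hξ hη hρ
    field_simp
    ring
  · field_simp
    ring
  · field_simp
    ring
  · subst hζ hξ hη hρ
    field_simp
    ring

theorem gMatrix_mul_gMatrix_inv (hx : x ≠ 0) (hq : ∀ n : ℕ, n ≠ 0 → x ^ n ≠ 1) {z : K}
    (hz : z ≠ 0) (h₁ : denom x z ≠ 0) (h₂ : denom x z⁻¹ ≠ 0) :
    gMatrix x z * gMatrix x z⁻¹ = 1 := by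
  rw [gMatrix, gMatrix, Matrix.smul_mul, Matrix.mul_smul,
    fMatrix_mul_fMatrix_inv hx hq (zeta_formula hx hq) (xi_formula hx hq) (eta_formula hx hq)
      (rho_formula hx hq) hz, smul_smul, smul_smul]
  convert one_smul K (1 : Matrix (Fin 2) (Fin 2) K) using 2
  rw [zpow_neg, zpow_ofNat]
  generalize denom x z⁻¹ = d at *
  field_simp

theorem eq_map_inv_of_inv_eq_map {L : Type*} [Field L] (φ : K →+* L) {c : K} {z : L}
    (h : z⁻¹ = φ c) : z = φ c⁻¹ := by
  rw [map_inv₀, ← h, inv_inv]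

end Field

theorem q_ne_zero : q ≠ 0 :=
  (map_ne_zero RatFunc.C).2 RatFunc.X_ne_zero

theorem C_X_pow (n : ℕ) : RatFunc.C (RatFunc.X ^ n : RatFunc ℂ) = q ^ n :=
  map_pow RatFunc.C _ _

theorem q_pow_ne_one (n : ℕ) (hn : n ≠ 0) : q ^ n ≠ 1 := by
  intro h
  have h1 : (RatFunc.X : RatFunc ℂ) ^ n = 1 :=
    (RatFunc.C (K := RatFunc ℂ)).injective ((C_X_pow n).trans (h.trans (map_one _).symm))
  have h2 : (Polynomial.X : Polynomial ℂ) ^ n = 1 := by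
    apply RatFunc.algebraMap_injective ℂ
    simpa using h1
  simpa [hn] using congrArg Polynomial.natDegree h2

theorem zvar_ne_C (c : RatFunc ℂ) : zvar ≠ RatFunc.C c := by
  intro h
  have h1 : (Polynomial.X : Polynomial (RatFunc ℂ)) = Polynomial.C c := by
    apply RatFunc.algebraMap_injective (RatFunc ℂ)
    simpa [zvar] using h
  exact Polynomial.X_ne_C c h1

theorem zvar_inv_ne_C (c : RatFunc ℂ) : zvar⁻¹ ≠ RatFunc.C c := fun h =>
  zvar_ne_C c⁻¹ (eq_map_inv_of_inv_eq_map RatFunc.C h)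

theorem denom_q_ne_zero {z : F} (h : ∀ c, z ≠ RatFunc.C c) : denom q z ≠ 0 :=
  denom_ne_zero q_ne_zero fun n _ =>
    ⟨fun e => h _ (e.trans (C_X_pow n).symm),
      fun e => h (-RatFunc.X ^ n)
        (e.trans ((congrArg _ (C_X_pow n).symm).trans (map_neg RatFunc.C _).symm))⟩

theorem g2_eq_gMatrix (z : F) : g2 z = gMatrix q z := rfl

/-- `g₂(1) = Id`, the inversion relation `g₂(z)g₂(z⁻¹) = Id`, and
`g₂(0) = diag(q^{-26}, q^{-2})` for type E₆^{(2)}. -/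
theorem E62_g2_properties :
    g2 1 = 1 ∧ g2 zvar * g2 zvar⁻¹ = 1 ∧
    g2 0 = !![q ^ (-26 : ℤ), 0; 0, q ^ (-2 : ℤ)] :=
  ⟨gMatrix_one q_ne_zero q_pow_ne_one,
    gMatrix_mul_gMatrix_inv q_ne_zero q_pow_ne_one RatFunc.X_ne_zero (denom_q_ne_zero zvar_ne_C)
      (denom_q_ne_zero zvar_inv_ne_C),
    gMatrix_zero q_ne_zero⟩

end
end Stmt16
end

section
/- The 3×3 multiplicity block g₁(z) of the R-matrix of type D₄^{(3)} on the three-dimensional multiplicity space of the summand L_{ω₁} satisfies g₁(1) = Id₃, the inversion relation g₁(z)·g₁(z⁻¹) = Id₃, and the matrix over ℂ(q) obtained by evaluating g₁(z) at z = q^{−2} (a regular point of all its entries) has rank exactly 1. -/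
open scoped Kronecker Matrix

set_option maxHeartbeats 1000000
set_option synthInstance.maxHeartbeats 1000000

namespace Stmt17

noncomputable section

/-- the quantum number `[n]_k = (q^{kn} - q^{-kn})/(q^k - q^{-k})`. -/
def qnum {F : Type*} [Field F] (q : F) (n k : ℤ) : F :=
  (q ^ (k * n) - q ^ (-(k * n))) / (q ^ k - q ^ (-k))

/-- the quantum number `[n]_kⁱ = (q^{kn} + (-1)^{n-1} q^{-kn})/(q^k + q^{-k})`. -/
def qnumi {F : Type*} [Field F] (q : F) (n k : ℤ) : F :=
  (q ^ (k * n) + (-1 : F) ^ (n - 1) * q ^ (-(k * n))) / (q ^ k + q ^ (-k))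

/-- `α = [2]ⁱ·[2]₃ⁱ/[2]`. -/
def alpha {F : Type*} [Field F] (q : F) : F := qnumi q 2 1 * qnumi q 2 3 / qnum q 2 1

/-- `β = [2]₃ⁱ/[2]`. -/
def beta {F : Type*} [Field F] (q : F) : F := qnumi q 2 3 / qnum q 2 1

/-- `γ = [2]₃ⁱ·[2]₄/[2]`. -/
def gam {F : Type*} [Field F] (q : F) : F := qnumi q 2 3 * qnum q 2 4 / qnum q 2 1

/-- `κ = [2]₂/[2]`. -/
def kap {F : Type*} [Field F] (q : F) : F := qnum q 2 2 / qnum q 2 1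

/-- the matrix `f_{ω₁}(z)` of type D₄^{(3)}. -/
def f {F : Type*} [Field F] (q z : F) : Matrix (Fin 3) (Fin 3) F :=
  !![-q ^ (-3 : ℤ) - q ^ (-2 : ℤ) * alpha q * z + q ^ (2 : ℤ) * alpha q * z ^ 2
        + q ^ (3 : ℤ) * z ^ 3,
      beta q * z * (1 - z), beta q * z * (1 - z);
    gam q * z * (1 - z), beta q * z * (q ^ (3 : ℤ) + q ^ (-3 : ℤ) * z),
      (1 - z) * (q ^ (3 : ℤ) + kap q * z + q ^ (-3 : ℤ) * z ^ 2);
    gam q * z * (1 - z), (1 - z) * (q ^ (3 : ℤ) + kap q * z + q ^ (-3 : ℤ) * z ^ 2),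
      beta q * z * (q ^ (3 : ℤ) + q ^ (-3 : ℤ) * z)]

/-- the 3×3 multiplicity block `g₁(z)` of the R-matrix of type D₄^{(3)}
on the multiplicity space of the summand `L_{ω₁}`. -/
def g1 {F : Type*} [Field F] (q z : F) : Matrix (Fin 3) (Fin 3) F :=
  (q ^ (-5 : ℤ) /
      ((1 - q ^ (-2 : ℤ) * z) * (1 + q ^ (-4 : ℤ) * z + q ^ (-8 : ℤ) * z ^ 2))) • f q z

abbrev F : Type := RatFunc (RatFunc ℂ)

def q : F := RatFunc.C RatFunc.X

/-- the spectral variable `z` -/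
def zvar : F := RatFunc.X

/-- If `q` is not a root of unity, then no power of `q` is equal to `-1`. -/
theorem pow_add_one_ne_zero {K : Type*} [Field K] {q : K} (hq : ∀ n : ℕ, 0 < n → q ^ n ≠ 1)
    {n : ℕ} (hn : 0 < n) : q ^ n + 1 ≠ 0 := by
  intro h
  apply hq (2 * n) (by omega)
  linear_combination (q ^ n - 1) * h

theorem pow_sub_one_ne_zero {K : Type*} [Field K] {q : K} (hq : ∀ n : ℕ, 0 < n → q ^ n ≠ 1)
    {n : ℕ} (hn : 0 < n) : q ^ n - 1 ≠ 0 :=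
  sub_ne_zero.2 (hq n hn)

theorem qnum_two {K : Type*} [Field K] {q : K} (hq₀ : q ≠ 0)
    (hq : ∀ n : ℕ, 0 < n → q ^ n ≠ 1) {k : ℕ} (hk : 0 < k) :
    qnum q 2 k = (q ^ (2 * k) + 1) / q ^ k := by
  have h : q ^ k * q ^ k - 1 ≠ 0 := by
    rw [← pow_add]
    exact pow_sub_one_ne_zero hq (by omega)
  have hk₀ : q ^ k ≠ 0 := pow_ne_zero k hq₀
  have h' : q ^ k - (q ^ k)⁻¹ ≠ 0 := by
    intro e
    apply h
    field_simp at e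
    linear_combination e
  rw [qnum, zpow_neg, zpow_neg, zpow_mul, zpow_natCast, zpow_ofNat, mul_comm 2 k, pow_mul,
    div_eq_div_iff h' hk₀]
  field_simp
  ring

theorem qnumi_two {K : Type*} [Field K] {q : K} (hq₀ : q ≠ 0)
    (hq : ∀ n : ℕ, 0 < n → q ^ n ≠ 1) {k : ℕ} (hk : 0 < k) :
    qnumi q 2 k = (q ^ (2 * k) - 1) / q ^ k := by
  have h : q ^ k * q ^ k + 1 ≠ 0 := by
    rw [← pow_add]
    exact pow_add_one_ne_zero hq (by omega)
  have hk₀ : q ^ k ≠ 0 := pow_ne_zero k hq₀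
  have h' : q ^ k + (q ^ k)⁻¹ ≠ 0 := by
    intro e
    apply h
    field_simp at e
    linear_combination e
  rw [qnumi, zpow_neg, zpow_neg, zpow_mul, zpow_natCast, zpow_ofNat, mul_comm 2 k, pow_mul,
    div_eq_div_iff h' hk₀, show (2 : ℤ) - 1 = 1 from rfl, zpow_one]
  field_simp
  ring

theorem beta_eq {K : Type*} [Field K] {q : K} (hq₀ : q ≠ 0) (hq : ∀ n : ℕ, 0 < n → q ^ n ≠ 1) :
    beta q = (q ^ 6 - 1) / (q ^ 2 * (q ^ 2 + 1)) := by
  have h1 := qnum_two hq₀ hq one_pos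
  have h3 := qnumi_two hq₀ hq three_pos
  have := pow_add_one_ne_zero hq two_pos
  push_cast at h1 h3
  rw [beta, h1, h3]
  field_simp

theorem alpha_eq {K : Type*} [Field K] {q : K} (hq₀ : q ≠ 0) (hq : ∀ n : ℕ, 0 < n → q ^ n ≠ 1) :
    alpha q = (q ^ 2 - 1) * (q ^ 6 - 1) / (q ^ 3 * (q ^ 2 + 1)) := by
  have h1 := qnumi_two hq₀ hq one_pos
  have := pow_add_one_ne_zero hq two_pos
  have h : alpha q = qnumi q 2 1 * beta q := mul_div_assoc _ _ _
  push_cast at h1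
  rw [h, h1, beta_eq hq₀ hq]
  field_simp

theorem gam_eq {K : Type*} [Field K] {q : K} (hq₀ : q ≠ 0) (hq : ∀ n : ℕ, 0 < n → q ^ n ≠ 1) :
    gam q = (q ^ 6 - 1) * (q ^ 8 + 1) / (q ^ 6 * (q ^ 2 + 1)) := by
  have h4 := qnum_two hq₀ hq four_pos
  have := pow_add_one_ne_zero hq two_pos
  have h : gam q = beta q * qnum q 2 4 := mul_div_right_comm _ _ _
  push_cast at h4
  rw [h, h4, beta_eq hq₀ hq]
  field_simp

theorem kap_eq {K : Type*} [Field K] {q : K} (hq₀ : q ≠ 0) (hq : ∀ n : ℕ, 0 < n → q ^ n ≠ 1) :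
    kap q = (q ^ 4 + 1) / (q * (q ^ 2 + 1)) := by
  have h1 := qnum_two hq₀ hq one_pos
  have h2 := qnum_two hq₀ hq two_pos
  have := pow_add_one_ne_zero hq two_pos
  push_cast at h1 h2
  rw [kap, h1, h2]
  field_simp

/-- The matrix `f(z)` with its denominators `q⁶` and `q² + 1` cleared. -/
def clearedF {K : Type*} [Field K] (q z : K) : Matrix (Fin 3) (Fin 3) K :=
  !![-q ^ 3 * (q ^ 2 + 1) - q * (q ^ 2 - 1) * (q ^ 6 - 1) * z
        + q ^ 5 * (q ^ 2 - 1) * (q ^ 6 - 1) * z ^ 2 + q ^ 9 * (q ^ 2 + 1) * z ^ 3,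
      q ^ 4 * (q ^ 6 - 1) * z * (1 - z), q ^ 4 * (q ^ 6 - 1) * z * (1 - z);
    (q ^ 6 - 1) * (q ^ 8 + 1) * z * (1 - z), q * (q ^ 6 - 1) * z * (q ^ 6 + z),
      (1 - z) * (q ^ 9 * (q ^ 2 + 1) + q ^ 5 * (q ^ 4 + 1) * z + q ^ 3 * (q ^ 2 + 1) * z ^ 2);
    (q ^ 6 - 1) * (q ^ 8 + 1) * z * (1 - z),
      (1 - z) * (q ^ 9 * (q ^ 2 + 1) + q ^ 5 * (q ^ 4 + 1) * z + q ^ 3 * (q ^ 2 + 1) * z ^ 2),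
      q * (q ^ 6 - 1) * z * (q ^ 6 + z)]

theorem f_eq {K : Type*} [Field K] {q : K} (hq₀ : q ≠ 0) (hq : ∀ n : ℕ, 0 < n → q ^ n ≠ 1)
    (z : K) : f q z = (q ^ 6 * (q ^ 2 + 1))⁻¹ • clearedF q z := by
  have := pow_add_one_ne_zero hq two_pos
  rw [f, clearedF, alpha_eq hq₀ hq, beta_eq hq₀ hq, gam_eq hq₀ hq, kap_eq hq₀ hq]
  simp only [zpow_neg, zpow_ofNat]
  ext i j
  fin_cases i <;> fin_cases j <;> simp <;> field_simp

theorem g1_eq {K : Type*} [Field K] {q : K} (hq₀ : q ≠ 0) (hq : ∀ n : ℕ, 0 < n → q ^ n ≠ 1)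
    (z : K) :
    g1 q z =
      (q * (q ^ 2 + 1) * ((q ^ 2 - z) * (q ^ 8 + q ^ 4 * z + z ^ 2)))⁻¹ • clearedF q z := by
  have := pow_add_one_ne_zero hq two_pos
  have e₁ : 1 - q ^ (-2 : ℤ) * z = (q ^ 2 - z) / q ^ 2 := by
    simp only [zpow_neg, zpow_ofNat]
    field_simp
  have e₂ : 1 + q ^ (-4 : ℤ) * z + q ^ (-8 : ℤ) * z ^ 2 =
      (q ^ 8 + q ^ 4 * z + z ^ 2) / q ^ 8 := by
    simp only [zpow_neg, zpow_ofNat]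
    field_simp
  rw [g1, f_eq hq₀ hq, smul_smul, e₁, e₂]
  congr 1
  simp only [zpow_neg, zpow_ofNat]
  field_simp

theorem quadratic_factor_ne_zero {K : Type*} [Field K] {q z : K} (h : z ^ 3 ≠ q ^ 12) :
    q ^ 8 + q ^ 4 * z + z ^ 2 ≠ 0 := by
  intro e
  apply h
  linear_combination (z - q ^ 4) * e

theorem g1_one {K : Type*} [Field K] {q : K} (hq₀ : q ≠ 0) (hq : ∀ n : ℕ, 0 < n → q ^ n ≠ 1) :
    g1 q 1 = 1 := by
  have h₀ := pow_add_one_ne_zero hq two_pos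
  have h₁ := pow_sub_one_ne_zero hq two_pos
  have h₂ : q ^ 8 + q ^ 4 * 1 + 1 ^ 2 ≠ 0 := quadratic_factor_ne_zero (by
    rw [one_pow]
    exact (hq 12 (by norm_num)).symm)
  rw [g1_eq hq₀ hq 1, inv_smul_eq_iff₀ (mul_ne_zero (mul_ne_zero hq₀ h₀) (mul_ne_zero h₁ h₂))]
  ext i j
  fin_cases i <;> fin_cases j <;> simp [clearedF] <;> ring

theorem clearedF_mul_clearedF_inv {K : Type*} [Field K] (q : K) {z : K} (hz : z ≠ 0) :
    clearedF q z * clearedF q z⁻¹ =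
      (q * (q ^ 2 + 1) * ((q ^ 2 - z) * (q ^ 8 + q ^ 4 * z + z ^ 2)) *
        (q * (q ^ 2 + 1) * ((q ^ 2 - z⁻¹) * (q ^ 8 + q ^ 4 * z⁻¹ + z⁻¹ ^ 2)))) •
        (1 : Matrix (Fin 3) (Fin 3) K) := by
  ext i j
  fin_cases i <;> fin_cases j <;>
    simp [clearedF, Matrix.mul_apply, Fin.sum_univ_three] <;> field_simp <;> ring

theorem g1_mul_g1_inv {K : Type*} [Field K] {q z : K} (hq₀ : q ≠ 0)
    (hq : ∀ n : ℕ, 0 < n → q ^ n ≠ 1) (hz₀ : z ≠ 0)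
    (h₁ : q ^ 2 - z ≠ 0) (h₂ : q ^ 8 + q ^ 4 * z + z ^ 2 ≠ 0)
    (h₃ : q ^ 2 - z⁻¹ ≠ 0) (h₄ : q ^ 8 + q ^ 4 * z⁻¹ + z⁻¹ ^ 2 ≠ 0) :
    g1 q z * g1 q z⁻¹ = 1 := by
  have h₀ := pow_add_one_ne_zero hq two_pos
  rw [g1_eq hq₀ hq z, g1_eq hq₀ hq z⁻¹, Matrix.smul_mul, Matrix.mul_smul,
    smul_smul, clearedF_mul_clearedF_inv q hz₀, ← mul_inv, inv_smul_smul₀]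
  exact mul_ne_zero (mul_ne_zero (mul_ne_zero hq₀ h₀) (mul_ne_zero h₁ h₂))
    (mul_ne_zero (mul_ne_zero hq₀ h₀) (mul_ne_zero h₃ h₄))

theorem rank_g1_zpow_neg_two {K : Type*} [Field K] {q : K} (hq₀ : q ≠ 0)
    (hq : ∀ n : ℕ, 0 < n → q ^ n ≠ 1) : (g1 q (q ^ (-2 : ℤ))).rank = 1 := by
  have hz : q ^ (-2 : ℤ) = (q ^ 2)⁻¹ := by rw [zpow_neg, zpow_ofNat]
  have h₀ := pow_add_one_ne_zero hq two_pos
  have h₁ : q ^ 2 - (q ^ 2)⁻¹ ≠ 0 := by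
    intro e
    apply hq 4 (by norm_num)
    field_simp at e
    linear_combination e
  have h₂ : q ^ 8 + q ^ 4 * (q ^ 2)⁻¹ + (q ^ 2)⁻¹ ^ 2 ≠ 0 := by
    refine quadratic_factor_ne_zero fun e ↦ hq 18 (by norm_num) ?_
    field_simp at e
    linear_combination -e
  rw [hz, g1_eq hq₀ hq]
  set c := (q * (q ^ 2 + 1) * ((q ^ 2 - (q ^ 2)⁻¹) *
    (q ^ 8 + q ^ 4 * (q ^ 2)⁻¹ + (q ^ 2)⁻¹ ^ 2)))⁻¹
  have hc₀ : c ≠ 0 := inv_ne_zero (mul_ne_zero (mul_ne_zero hq₀ h₀) (mul_ne_zero h₁ h₂))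
  have h_factor : c • clearedF q (q ^ 2)⁻¹ =
      Matrix.vecMulVec (c • ![q ^ 3 * (q ^ 2 - 1), q ^ 8 + 1, q ^ 8 + 1])
        (((q ^ 6 - 1) / q ^ 3) • ![(q ^ 2 - 1) / q, 1, 1]) := by
    rw [Matrix.smul_vecMulVec]
    congr 1
    ext i j
    fin_cases i <;> fin_cases j <;>
      simp [clearedF, Matrix.vecMulVec_apply] <;> field_simp <;> ring
  apply le_antisymm
  · rw [h_factor]
    exact Matrix.rank_vecMulVec_le _ _
  · rw [Nat.one_le_iff_ne_zero, Matrix.rank, Ne, Submodule.finrank_eq_zero,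
      LinearMap.range_eq_bot, ← Matrix.toLin'_apply', LinearEquiv.map_eq_zero_iff]
    intro h
    have h₀₁ := congrFun (congrFun (h_factor.symm.trans h) 0) 1
    have h₆ := pow_sub_one_ne_zero hq (show 0 < 6 by norm_num)
    have h₂' := pow_sub_one_ne_zero hq two_pos
    simp [Matrix.vecMulVec_apply, hc₀, hq₀, h₆, h₂'] at h₀₁

theorem ratFunc_X_pow_ne_C {K : Type*} [Field K] {n : ℕ} (hn : 0 < n) (a : K) :
    (RatFunc.X : RatFunc K) ^ n ≠ RatFunc.C a := by
  rw [← RatFunc.algebraMap_X, ← RatFunc.algebraMap_C, ← map_pow, Ne,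
    (RatFunc.algebraMap_injective K).eq_iff]
  intro h
  have := congrArg Polynomial.natDegree h
  rw [Polynomial.natDegree_X_pow, Polynomial.natDegree_C] at this
  omega

theorem ratFunc_X_pow_ne_one {K : Type*} [Field K] {n : ℕ} (hn : 0 < n) :
    (RatFunc.X : RatFunc K) ^ n ≠ 1 := by
  rw [← map_one (RatFunc.C (K := K))]
  exact ratFunc_X_pow_ne_C hn 1

theorem q_ne_zero : q ≠ 0 :=
  (map_ne_zero _).2 RatFunc.X_ne_zero

theorem q_pow_ne_one (n : ℕ) (hn : 0 < n) : q ^ n ≠ 1 := by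
  intro h
  apply ratFunc_X_pow_ne_one (K := ℂ) hn
  apply RatFunc.C.injective
  rw [map_pow, map_one]
  exact h

theorem zvar_pow_ne {n : ℕ} (hn : 0 < n) (m : ℕ) : zvar ^ n ≠ q ^ m := by
  rw [q, ← map_pow]
  exact ratFunc_X_pow_ne_C hn _

theorem inv_zvar_pow_ne {n : ℕ} (hn : 0 < n) (m : ℕ) : zvar⁻¹ ^ n ≠ q ^ m := by
  intro h
  apply ratFunc_X_pow_ne_C hn ((RatFunc.X : RatFunc ℂ) ^ m)⁻¹
  rw [map_inv₀, map_pow]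
  exact inv_eq_iff_eq_inv.1 ((inv_pow zvar n).symm.trans h)

/-- `g₁(1) = Id`, the inversion relation `g₁(z)g₁(z⁻¹) = Id`, and rank 1 at `z = q⁻²`
for the 3×3 multiplicity block of type D₄^{(3)}. -/
theorem D43_g1_properties :
    g1 q (1 : F) = 1 ∧ g1 q zvar * g1 q zvar⁻¹ = 1 ∧
    (g1 (RatFunc.X : RatFunc ℂ) ((RatFunc.X : RatFunc ℂ) ^ (-2 : ℤ))).rank = 1 := by
  refine ⟨g1_one q_ne_zero q_pow_ne_one, ?_,
    rank_g1_zpow_neg_two RatFunc.X_ne_zero fun _ ↦ ratFunc_X_pow_ne_one⟩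
  refine g1_mul_g1_inv q_ne_zero q_pow_ne_one RatFunc.X_ne_zero
    (sub_ne_zero.2 fun h ↦ zvar_pow_ne one_pos 2 ?_)
    (quadratic_factor_ne_zero (zvar_pow_ne three_pos 12))
    (sub_ne_zero.2 fun h ↦ inv_zvar_pow_ne one_pos 2 ?_)
    (quadratic_factor_ne_zero (inv_zvar_pow_ne three_pos 12))
  · rw [pow_one, h]
  · rw [pow_one, h]

end
end Stmt17
end

section
/- The 2×2 multiplicity block g₂(z) of the R-matrix of type D₄^{(3)} on the two-dimensional multiplicity space of the trivial summand L_{ω₀} satisfies g₂(1) = Id₂, the inversion relation g₂(z)·g₂(z⁻¹) = Id₂, and g₂(0) = diag(q^{−14}, q^{−2}). -/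
open scoped Kronecker Matrix

set_option maxHeartbeats 1000000
set_option synthInstance.maxHeartbeats 1000000

namespace Stmt18

noncomputable section

/-- the quantum number `[n]_k = (q^{kn} - q^{-kn})/(q^k - q^{-k})`. -/
def qnum {F : Type*} [Field F] (q : F) (n k : ℤ) : F :=
  (q ^ (k * n) - q ^ (-(k * n))) / (q ^ k - q ^ (-k))

/-- the quantum number `[n]_kⁱ = (q^{kn} + (-1)^{n-1} q^{-kn})/(q^k + q^{-k})`. -/
def qnumi {F : Type*} [Field F] (q : F) (n k : ℤ) : F :=
  (q ^ (k * n) + (-1 : F) ^ (n - 1) * q ^ (-(k * n))) / (q ^ k + q ^ (-k))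

abbrev F : Type := RatFunc (RatFunc ℂ)

def q : F := RatFunc.C RatFunc.X

/-- the spectral variable `z` -/
def zvar : F := RatFunc.X

/-- `ζ = [2]₄/[2]`. -/
def zeta : F := qnum q 2 4 / qnum q 2 1

/-- `ξ = [2]ⁱ·[2]₃ⁱ·[2]₄`. -/
def xi : F := qnumi q 2 1 * qnumi q 2 3 * qnum q 2 4

/-- `η = [2]₃ⁱ/[2]`. -/
def eta : F := qnumi q 2 3 / qnum q 2 1

/-- `ρ = [2]₃ⁱ·[3]₂ⁱ·[7]/[2]`. -/
def rho : F := qnumi q 2 3 * qnumi q 3 2 * qnum q 7 1 / qnum q 2 1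

/-- the matrix `f_{ω₀}(z)` of type D₄^{(3)}. -/
def f (z : F) : Matrix (Fin 2) (Fin 2) F :=
  !![q ^ (-6 : ℤ) - q ^ (-3 : ℤ) * zeta * z + xi * z ^ 2 - q ^ (3 : ℤ) * zeta * z ^ 3
        + q ^ (6 : ℤ) * z ^ 4,
      eta * z * (1 - z ^ 2);
    rho * z * (1 - z ^ 2),
      q ^ (6 : ℤ) - q ^ (3 : ℤ) * zeta * z + xi * z ^ 2 - q ^ (-3 : ℤ) * zeta * z ^ 3
        + q ^ (-6 : ℤ) * z ^ 4]

/-- the 2×2 multiplicity block `g₂(z)` of the R-matrix of type D₄^{(3)}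
on the multiplicity space of the trivial summand `L_{ω₀}`. -/
def g2 (z : F) : Matrix (Fin 2) (Fin 2) F :=
  (q ^ (-8 : ℤ) /
      ((1 - q ^ (-2 : ℤ) * z) * (1 - q ^ (-6 : ℤ) * z) *
        (1 + q ^ (-4 : ℤ) * z + q ^ (-8 : ℤ) * z ^ 2))) • f z

section Generic

variable {K : Type*} [Field K]

theorem qnum_two (x : K) {k : ℤ} (hk : x ^ k - x ^ (-k) ≠ 0) :
    qnum x 2 k = x ^ k + x ^ (-k) := by
  by_cases hx : x = 0
  · subst hx
    rcases eq_or_ne k 0 with rfl | h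
    · simp at hk
    · simp [zero_zpow _ h] at hk
  rw [qnum, div_eq_iff hk, mul_two, neg_add, zpow_add₀ hx, zpow_add₀ hx]
  ring

theorem qnumi_two (x : K) {k : ℤ} (hk : x ^ k + x ^ (-k) ≠ 0) :
    qnumi x 2 k = x ^ k - x ^ (-k) := by
  by_cases hx : x = 0
  · subst hx
    rcases eq_or_ne k 0 with rfl | h
    · simp [qnumi]
    · simp [zero_zpow _ h] at hk
  rw [qnumi, div_eq_iff hk, mul_two, neg_add, zpow_add₀ hx, zpow_add₀ hx]
  norm_num
  ring

variable {x : K}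

theorem zpow_sub_zpow_neg_ne_zero (hx : x ≠ 0) (hx' : ∀ n : ℕ, n ≠ 0 → x ^ n ≠ 1) {k : ℕ}
    (hk : k ≠ 0) : x ^ (k : ℤ) - x ^ (-(k : ℤ)) ≠ 0 := by
  intro h
  apply hx' (k + k) (by omega)
  rw [zpow_neg, zpow_natCast, sub_eq_zero] at h
  rw [pow_add]
  nth_rewrite 1 [h]
  exact inv_mul_cancel₀ (pow_ne_zero _ hx)

theorem zpow_add_zpow_neg_ne_zero (hx : x ≠ 0) (hx' : ∀ n : ℕ, n ≠ 0 → x ^ n ≠ 1) {k : ℕ}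
    (hk : k ≠ 0) : x ^ (k : ℤ) + x ^ (-(k : ℤ)) ≠ 0 := by
  intro h
  apply zpow_sub_zpow_neg_ne_zero hx hx' (k := k + k) (by omega)
  push_cast
  rw [neg_add, zpow_add₀ hx, zpow_add₀ hx]
  linear_combination (x ^ (k : ℤ) - x ^ (-(k : ℤ))) * h

theorem qnumi_three_two (hx : x ≠ 0) (h : x ^ (2 : ℤ) + x ^ (-2 : ℤ) ≠ 0) :
    qnumi x 3 2 = x ^ (4 : ℤ) - 1 + x ^ (-4 : ℤ) := by
  rw [qnumi, div_eq_iff h]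
  norm_num [zpow_neg]
  norm_cast
  field_simp
  ring

theorem qnum_seven_one (hx : x ≠ 0) (h : x ^ (1 : ℤ) - x ^ (-1 : ℤ) ≠ 0) : qnum x 7 1 =
    x ^ (6 : ℤ) + x ^ (4 : ℤ) + x ^ (2 : ℤ) + 1 + x ^ (-2 : ℤ) + x ^ (-4 : ℤ) + x ^ (-6 : ℤ) := by
  rw [qnum, div_eq_iff h]
  norm_num [zpow_neg]
  norm_cast
  field_simp
  ring

/-- The matrix `f` over an arbitrary field, with free coefficients. -/
def fGen (x ζ ξ η ρ z : K) : Matrix (Fin 2) (Fin 2) K :=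
  !![x ^ (-6 : ℤ) - x ^ (-3 : ℤ) * ζ * z + ξ * z ^ 2 - x ^ (3 : ℤ) * ζ * z ^ 3
        + x ^ (6 : ℤ) * z ^ 4,
      η * z * (1 - z ^ 2);
    ρ * z * (1 - z ^ 2),
      x ^ (6 : ℤ) - x ^ (3 : ℤ) * ζ * z + ξ * z ^ 2 - x ^ (-3 : ℤ) * ζ * z ^ 3
        + x ^ (-6 : ℤ) * z ^ 4]

theorem fGen_inv {ζ ξ η ρ z : K} (hz : z ≠ 0) (hx : x ≠ 0) :
    fGen x ζ ξ η ρ z⁻¹ = (z ^ 4)⁻¹ • (fGen x ζ ξ η ρ z).adjugate := by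
  rw [fGen, fGen, Matrix.adjugate_fin_two_of]
  simp only [zpow_neg]
  norm_cast
  ext i j
  fin_cases i <;> fin_cases j <;> simp <;> field_simp <;> ring

/-- The matrix `f` over an arbitrary field. -/
def fOf (x z : K) : Matrix (Fin 2) (Fin 2) K :=
  fGen x (qnum x 2 4 / qnum x 2 1) (qnumi x 2 1 * qnumi x 2 3 * qnum x 2 4)
    (qnumi x 2 3 / qnum x 2 1) (qnumi x 2 3 * qnumi x 3 2 * qnum x 7 1 / qnum x 2 1) z

/-- The denominator of the scalar prefactor of `g2`, over an arbitrary field. -/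
def den (x z : K) : K :=
  (1 - x ^ (-2 : ℤ) * z) * (1 - x ^ (-6 : ℤ) * z) *
    (1 + x ^ (-4 : ℤ) * z + x ^ (-8 : ℤ) * z ^ 2)

/-- The matrix `g2` over an arbitrary field. -/
def gOf (x z : K) : Matrix (Fin 2) (Fin 2) K := (x ^ (-8 : ℤ) / den x z) • fOf x z

theorem den_ne_zero (hx : x ≠ 0) {z : K} (h₁ : z ≠ x ^ 2) (h₂ : z ≠ x ^ 6)
    (h₃ : z ^ 3 ≠ x ^ 12) : den x z ≠ 0 := by
  refine mul_ne_zero (mul_ne_zero ?_ ?_) ?_ <;> intro h <;> simp only [zpow_neg] at h <;>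
    norm_cast at h <;> field_simp at h
  · exact h₁ (by linear_combination -h)
  · exact h₂ (by linear_combination -h)
  · exact h₃ (by linear_combination (z - x ^ 4) * h)

theorem fOf_eq (hx : x ≠ 0) (hx' : ∀ n : ℕ, n ≠ 0 → x ^ n ≠ 1) (z : K) :
    fOf x z = fGen x ((x ^ (4 : ℤ) + x ^ (-4 : ℤ)) / (x + x⁻¹))
      ((x - x⁻¹) * (x ^ (3 : ℤ) - x ^ (-3 : ℤ)) * (x ^ (4 : ℤ) + x ^ (-4 : ℤ)))
      ((x ^ (3 : ℤ) - x ^ (-3 : ℤ)) / (x + x⁻¹))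
      ((x ^ (3 : ℤ) - x ^ (-3 : ℤ)) * (x ^ (4 : ℤ) - 1 + x ^ (-4 : ℤ)) *
        (x ^ (6 : ℤ) + x ^ (4 : ℤ) + x ^ (2 : ℤ) + 1 + x ^ (-2 : ℤ) + x ^ (-4 : ℤ) +
          x ^ (-6 : ℤ)) / (x + x⁻¹)) z := by
  have hsub {k : ℕ} (hk : k ≠ 0) := zpow_sub_zpow_neg_ne_zero hx hx' hk
  have hadd {k : ℕ} (hk : k ≠ 0) := zpow_add_zpow_neg_ne_zero hx hx' hk
  have e₁ : qnum x 2 1 = x + x⁻¹ := by simpa using qnum_two x (hsub one_ne_zero)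
  have e₂ : qnum x 2 4 = x ^ (4 : ℤ) + x ^ (-4 : ℤ) := qnum_two x (hsub four_ne_zero)
  have e₃ : qnumi x 2 1 = x - x⁻¹ := by simpa using qnumi_two x (hadd one_ne_zero)
  have e₄ : qnumi x 2 3 = x ^ (3 : ℤ) - x ^ (-3 : ℤ) := qnumi_two x (hadd three_ne_zero)
  rw [fOf, e₁, e₂, e₃, e₄, qnumi_three_two hx (hadd two_ne_zero),
    qnum_seven_one hx (hsub one_ne_zero)]

theorem sq_add_one_ne_zero_of_pow_ne_one (hx' : ∀ n : ℕ, n ≠ 0 → x ^ n ≠ 1) : x ^ 2 + 1 ≠ 0 :=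
  fun h => hx' 4 four_ne_zero (by linear_combination (x ^ 2 - 1) * h)

theorem fOf_one (hx : x ≠ 0) (hx' : ∀ n : ℕ, n ≠ 0 → x ^ n ≠ 1) :
    fOf x 1 = (x ^ 8 * den x 1) • (1 : Matrix (Fin 2) (Fin 2) K) := by
  have h := sq_add_one_ne_zero_of_pow_ne_one hx'
  rw [fOf_eq hx hx', fGen, den]
  simp only [zpow_neg]
  norm_cast
  ext i j
  fin_cases i <;> fin_cases j <;> simp <;> field_simp <;> ring

theorem det_fOf (hx : x ≠ 0) (hx' : ∀ n : ℕ, n ≠ 0 → x ^ n ≠ 1) {z : K} (hz : z ≠ 0) :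
    (fOf x z).det = x ^ 16 * z ^ 4 * (den x z * den x z⁻¹) := by
  have h := sq_add_one_ne_zero_of_pow_ne_one hx'
  rw [fOf_eq hx hx', fGen, Matrix.det_fin_two_of, den, den]
  simp only [zpow_neg]
  norm_cast
  field_simp
  ring

theorem gOf_one (hx : x ≠ 0) (hx' : ∀ n : ℕ, n ≠ 0 → x ^ n ≠ 1) : gOf x 1 = 1 := by
  have hd : den x 1 ≠ 0 := den_ne_zero hx (hx' 2 two_ne_zero).symm
    (hx' 6 (by norm_num)).symm (by simpa using (hx' 12 (by norm_num)).symm)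
  rw [gOf, fOf_one hx hx', smul_smul, zpow_neg]
  norm_cast
  field_simp
  exact one_smul _ _

theorem gOf_mul_gOf_inv (hx : x ≠ 0) (hx' : ∀ n : ℕ, n ≠ 0 → x ^ n ≠ 1) {z : K} (hz : z ≠ 0)
    (hz' : ∀ n : ℕ, n ≠ 0 → ∀ m : ℤ, z ^ n ≠ x ^ m) : gOf x z * gOf x z⁻¹ = 1 := by
  have hd : den x z ≠ 0 := den_ne_zero hx (by simpa using hz' 1 one_ne_zero (2 : ℕ))
    (by simpa using hz' 1 one_ne_zero (6 : ℕ)) (by simpa using hz' 3 three_ne_zero (12 : ℕ))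
  have key {n : ℕ} (hn : n ≠ 0) (m : ℕ) : z⁻¹ ^ n ≠ x ^ m := fun h =>
    hz' n hn (-m) (by rw [zpow_neg, zpow_natCast, ← h, inv_pow, inv_inv])
  have hd' : den x z⁻¹ ≠ 0 := den_ne_zero hx (by simpa using key one_ne_zero 2)
    (by simpa using key one_ne_zero 6) (key three_ne_zero 12)
  have hf : fOf x z⁻¹ = (z ^ 4)⁻¹ • (fOf x z).adjugate := fGen_inv hz hx
  rw [gOf, gOf, hf, smul_smul, Matrix.smul_mul, Matrix.mul_smul,
    Matrix.mul_adjugate, det_fOf hx hx' hz, smul_smul, smul_smul, zpow_neg]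
  norm_cast
  generalize den x z⁻¹ = d at hd'
  field_simp
  exact one_smul _ _

theorem gOf_zero (hx : x ≠ 0) : gOf x 0 = !![x ^ (-14 : ℤ), 0; 0, x ^ (-2 : ℤ)] := by
  ext i j
  fin_cases i <;> fin_cases j <;> simp [gOf, fOf, fGen, den] <;>
    field_simp

theorem X_pow_ne_C {n : ℕ} (hn : n ≠ 0) (c : K) :
    (RatFunc.X : RatFunc K) ^ n ≠ RatFunc.C c := by
  rw [← RatFunc.algebraMap_X, ← RatFunc.algebraMap_C, ← map_pow,
    (RatFunc.algebraMap_injective K).ne_iff]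
  intro h
  simpa [hn] using congrArg Polynomial.natDegree h

theorem C_X_pow_ne_one {n : ℕ} (hn : n ≠ 0) :
    (RatFunc.C (RatFunc.X : RatFunc K)) ^ n ≠ 1 := by
  rw [← map_pow, ← map_one RatFunc.C]
  exact fun h => X_pow_ne_C hn 1 ((RatFunc.C.injective h).trans (map_one RatFunc.C).symm)

theorem X_pow_ne_C_zpow {n : ℕ} (hn : n ≠ 0) (c : K) (m : ℤ) :
    (RatFunc.X : RatFunc K) ^ n ≠ RatFunc.C c ^ m :=
  fun h => X_pow_ne_C hn (c ^ m) (h.trans (map_zpow₀ RatFunc.C c m).symm)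

end Generic

/-- `g₂(1) = Id`, the inversion relation `g₂(z)g₂(z⁻¹) = Id`, and
`g₂(0) = diag(q^{-14}, q^{-2})` for type D₄^{(3)}. -/
theorem D43_g2_properties :
    g2 1 = 1 ∧ g2 zvar * g2 zvar⁻¹ = 1 ∧
    g2 0 = !![q ^ (-14 : ℤ), 0; 0, q ^ (-2 : ℤ)] := by
  have hq : q ≠ 0 := (map_ne_zero RatFunc.C).2 RatFunc.X_ne_zero
  have hq' (n : ℕ) (hn : n ≠ 0) : q ^ n ≠ 1 := C_X_pow_ne_one hn
  exact ⟨gOf_one hq hq', gOf_mul_gOf_inv hq hq' RatFunc.X_ne_zero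
    fun n hn m => X_pow_ne_C_zpow hn _ m, gOf_zero hq⟩

end
end Stmt18
end
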